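/- arXiv:2106.05305 — 2 statements merged into one kernel-verified Lean document; each statement's English description precedes it below -/
import Mathlib

section
/- Let n ≥ 2 and let A be an n-qubit architecture with R = T·L gates that is the concatenation of T consecutive causal slices of L gates each, where T ≤ 2^{n+1} − 2. Define the smooth map G^A : SU(4)^{×R} → S^{2·2^n − 1} ⊂ ℂ^{2^n} by G^A(x) = F^A(x)|0^n⟩, where S^{2·2^n − 1} is the unit sphere of ℂ^{2^n}. Then there exists a point x ∈ SU(4)^{×R}, all of whose entries are Clifford gates, at which the rank of the differential of G^A is at least T. -/
open scoped Matrix ENNReal Classical Kronecker ComplexOrder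
open MeasureTheory

/-! ## Basic objects: qubit bases, gates, architectures, contraction maps -/

/-- Computational-basis index set for `n` qubits. -/
abbrev QubitBasis (n : ℕ) := Fin n → Fin 2

/-- `2^n × 2^n` complex matrices, indexed by the computational basis of `n` qubits. -/
abbrev NMatrix (n : ℕ) := Matrix (QubitBasis n) (QubitBasis n) ℂ

/-- The special unitary group `SU(4)` of two-qubit gates. -/
abbrev SU4 := Matrix.specialUnitaryGroup (Fin 4) ℂ

/-- An architecture on `n` qubits with `R` gates: a list of ordered pairs of distinct qubits. -/
def Architecture (n R : ℕ) := Fin R → {p : Fin n × Fin n // p.1 ≠ p.2}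

/-- Identification of a pair of one-qubit basis indices with a two-qubit basis index. -/
def pairIdx (a b : Fin 2) : Fin 4 := ⟨2 * a.val + b.val, by omega⟩

/-- The `n`-qubit matrix given by letting the two-qubit matrix `u` act on the
tensor factors `p.1` and `p.2`, and as the identity on all other factors. -/
noncomputable def embedGate {n : ℕ} (p : Fin n × Fin n) (u : Matrix (Fin 4) (Fin 4) ℂ) :
    NMatrix n := fun a b =>
  if (∀ i, i ≠ p.1 → i ≠ p.2 → a i = b i)
  then u (pairIdx (a p.1) (a p.2)) (pairIdx (b p.1) (b p.2)) else 0

/-- The list of `n`-qubit gates obtained by substituting the gates `x` into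
the architecture `A`. -/
noncomputable def gateList {n R : ℕ} (A : Architecture n R) (x : Fin R → SU4) :
    List (NMatrix n) :=
  List.ofFn fun i => embedGate (A i).1 (x i : Matrix (Fin 4) (Fin 4) ℂ)

/-- The contraction map `F^A` of an architecture `A`: it sends a tuple of two-qubit gates
`(u_1, …, u_R)` to the `n`-qubit unitary `(u_R)_{p_R} ⋯ (u_1)_{p_1}`. -/
noncomputable def contract {n R : ℕ} (A : Architecture n R) (x : Fin R → SU4) : NMatrix n :=
  ((gateList A x).reverse).prod

/-- The exact circuit complexity: the least number `R` of two-qubit gates, arranged in any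
architecture, implementing the matrix `U`. -/
noncomputable def Cu (n : ℕ) (U : NMatrix n) : ℕ :=
  sInf {R | ∃ A : Architecture n R, ∃ x : Fin R → SU4, contract A x = U}

/-- The all-zeros computational basis state `|0^n⟩`. -/
noncomputable def ket0 (n : ℕ) : QubitBasis n → ℂ := fun a => if a = fun _ => 0 then 1 else 0

/-- The exact state complexity: the least number `R` of two-qubit gates, arranged in any
architecture, producing `ψ` from `|0^n⟩`. -/
noncomputable def Cstate (n : ℕ) (ψ : QubitBasis n → ℂ) : ℕ :=
  sInf {R | ∃ A : Architecture n R, ∃ x : Fin R → SU4, (contract A x) *ᵥ ket0 n = ψ}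

/-- The gates with indices `lo ≤ i < hi` of `A` form a causal slice with sink qubit `t`:
every qubit `q` is connected to `t` by a path through gates of the slice, taken in
increasing index order. -/
def IsCausalSliceWith {n R : ℕ} (A : Architecture n R) (lo hi : ℕ) (t : Fin n) : Prop :=
  ∀ q : Fin n, ∃ (m : ℕ) (idx : Fin m → Fin R) (qs : Fin (m + 1) → Fin n),
    StrictMono idx ∧ (∀ l, lo ≤ (idx l : ℕ) ∧ (idx l : ℕ) < hi) ∧
    qs 0 = q ∧ qs (Fin.last m) = t ∧
    ∀ l : Fin m,
      (qs l.castSucc = (A (idx l)).1.1 ∨ qs l.castSucc = (A (idx l)).1.2) ∧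
      (qs l.succ = (A (idx l)).1.1 ∨ qs l.succ = (A (idx l)).1.2)

/-- The gates with indices `lo ≤ i < hi` of `A` form a causal slice. -/
def IsCausalSlice {n R : ℕ} (A : Architecture n R) (lo hi : ℕ) : Prop :=
  ∃ t, IsCausalSliceWith A lo hi t

/-! ## Group, topological, measurable and compactness structure on `SU(4)`,
and its Haar probability measure -/

namespace SU4

theorem star_mem {U : Matrix (Fin 4) (Fin 4) ℂ}
    (hU : U ∈ Matrix.specialUnitaryGroup (Fin 4) ℂ) :
    star U ∈ Matrix.specialUnitaryGroup (Fin 4) ℂ := by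
  rw [Matrix.mem_specialUnitaryGroup_iff] at hU ⊢
  refine ⟨Unitary.star_mem hU.1, ?_⟩
  have : (star U).det = star U.det := by
    simp [Matrix.star_eq_conjTranspose, Matrix.det_conjTranspose]
  rw [this, hU.2]
  simp

noncomputable instance : Group SU4 :=
  { (inferInstance : Monoid SU4) with
    inv := fun U => ⟨star U.1, star_mem U.2⟩
    inv_mul_cancel := fun U => Subtype.ext <| by
      have h := (Matrix.mem_specialUnitaryGroup_iff.mp U.2).1.1
      simpa using h }

instance : IsTopologicalGroup SU4 where
  continuous_mul := by
    apply Continuous.subtype_mk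
    exact ((continuous_subtype_val.comp continuous_fst).matrix_mul
      (continuous_subtype_val.comp continuous_snd))
  continuous_inv := by
    apply Continuous.subtype_mk
    exact continuous_star.comp continuous_subtype_val

noncomputable instance : MeasurableSpace (Matrix (Fin 4) (Fin 4) ℂ) :=
  inferInstanceAs (MeasurableSpace (Fin 4 → Fin 4 → ℂ))

instance : BorelSpace (Matrix (Fin 4) (Fin 4) ℂ) :=
  inferInstanceAs (BorelSpace (Fin 4 → Fin 4 → ℂ))

theorem isClosed :
    IsClosed (Matrix.specialUnitaryGroup (Fin 4) ℂ : Set (Matrix (Fin 4) (Fin 4) ℂ)) := by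
  have h1 : IsClosed {M : Matrix (Fin 4) (Fin 4) ℂ | star M * M = 1} :=
    isClosed_eq ((continuous_id.matrix_conjTranspose).matrix_mul continuous_id) continuous_const
  have h2 : IsClosed {M : Matrix (Fin 4) (Fin 4) ℂ | M * star M = 1} :=
    isClosed_eq (continuous_id.matrix_mul (continuous_id.matrix_conjTranspose)) continuous_const
  have h3 : IsClosed {M : Matrix (Fin 4) (Fin 4) ℂ | M.det = 1} :=
    isClosed_eq continuous_id.matrix_det continuous_const
  have : (Matrix.specialUnitaryGroup (Fin 4) ℂ : Set (Matrix (Fin 4) (Fin 4) ℂ)) =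
      ({M | star M * M = 1} ∩ {M | M * star M = 1}) ∩ {M | M.det = 1} := by
    ext M
    simp only [SetLike.mem_coe, Matrix.mem_specialUnitaryGroup_iff, Unitary.mem_iff,
      Set.mem_inter_iff, Set.mem_setOf_eq]
  rw [this]
  exact ((h1.inter h2)).inter h3

theorem isCompact :
    IsCompact (Matrix.specialUnitaryGroup (Fin 4) ℂ : Set (Matrix (Fin 4) (Fin 4) ℂ)) := by
  have hK : IsCompact (Set.pi Set.univ fun _ : Fin 4 => Set.pi Set.univ fun _ : Fin 4 =>
      Metric.closedBall (0 : ℂ) 1 : Set (Matrix (Fin 4) (Fin 4) ℂ)) :=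
    isCompact_univ_pi fun _ => isCompact_univ_pi fun _ => isCompact_closedBall _ _
  refine IsCompact.of_isClosed_subset hK isClosed ?_
  intro M hM
  refine fun i _ => fun j _ => ?_
  simp only [Metric.mem_closedBall, dist_zero_right]
  exact entry_norm_bound_of_unitary (Matrix.mem_specialUnitaryGroup_iff.mp hM).1 i j

instance : CompactSpace SU4 :=
  isCompact_iff_compactSpace.mp isCompact

noncomputable instance : MeasurableSpace SU4 := borel SU4

instance : BorelSpace SU4 := ⟨rfl⟩

end SU4

/-- The Haar probability measure on `SU(4)`. -/
noncomputable def haarSU4 : Measure SU4 :=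
  Measure.haarMeasure ⟨⟨Set.univ, isCompact_univ⟩, by simp⟩

instance : IsProbabilityMeasure haarSU4 := by
  constructor
  have h : Measure.haarMeasure
      (⟨⟨Set.univ, isCompact_univ⟩, by simp⟩ : TopologicalSpace.PositiveCompacts SU4)
      (⟨⟨Set.univ, isCompact_univ⟩, by simp⟩ : TopologicalSpace.PositiveCompacts SU4) = 1 :=
    Measure.haarMeasure_self
  simpa [haarSU4] using h

/-- The product of Haar probability measures on `SU(4)^{×R}`: the distribution of a random
quantum circuit with `R` gates in a fixed architecture. -/
noncomputable def muSU4 (R : ℕ) : Measure (Fin R → SU4) :=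
  Measure.pi fun _ => haarSU4

/-! ## The differential of the contraction map, its rank, and the accessible dimension -/

/-- The Lie algebra `su(m)` of traceless skew-Hermitian matrices, as a real subspace. -/
noncomputable def suAlgebra (m : Type*) [Fintype m] [DecidableEq m] :
    Submodule ℝ (Matrix m m ℂ) :=
  Submodule.span ℝ {H | Hᴴ = -H ∧ H.trace = 0}

/-- `embedGate` as a real-linear map in the gate entry. -/
noncomputable def embedLin {n : ℕ} (p : Fin n × Fin n) :
    Matrix (Fin 4) (Fin 4) ℂ →ₗ[ℝ] NMatrix n where
  toFun := embedGate p
  map_add' u v := by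
    funext a b
    simp only [embedGate, Matrix.add_apply]
    split <;> simp
  map_smul' r u := by
    funext a b
    simp only [embedGate, Matrix.smul_apply, RingHom.id_apply]
    split <;> simp

/-- The differential of the contraction map `F^A` at the point `x ∈ SU(4)^{×R}`, read in the
exponential charts: the direction `(H_1, …, H_R)` is mapped to
`∑_j (U_R)_{p_R} ⋯ (U_{j+1})_{p_{j+1}} · (H_j)_{p_j} · (U_j)_{p_j} ⋯ (U_1)_{p_1}`. -/
noncomputable def contractDiff {n R : ℕ} (A : Architecture n R) (x : Fin R → SU4) :
    (Fin R → Matrix (Fin 4) (Fin 4) ℂ) →ₗ[ℝ] NMatrix n :=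
  ∑ j : Fin R,
    (LinearMap.mulLeft ℝ (((gateList A x).drop (j + 1)).reverse.prod)) ∘ₗ
      (LinearMap.mulRight ℝ
        (embedGate (A j).1 (x j : Matrix (Fin 4) (Fin 4) ℂ) *
          ((gateList A x).take j).reverse.prod)) ∘ₗ
      (embedLin (A j).1) ∘ₗ
      (LinearMap.proj j)

/-- The rank of (the differential of) the contraction map `F^A` at `x`: the dimension of
the image, under the differential, of the tangent space `su(4)^{×R}`. -/
noncomputable def rankAt {n R : ℕ} (A : Architecture n R) (x : Fin R → SU4) : ℕ :=
  Module.finrank ℝ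
    ↥(Submodule.map (contractDiff A x) (Submodule.pi Set.univ fun _ => suAlgebra (Fin 4)))

/-- The maximal rank `r_max` of the contraction map `F^A` over all points of `SU(4)^{×R}`. -/
noncomputable def rmax {n R : ℕ} (A : Architecture n R) : ℕ := ⨆ x, rankAt A x

/-- A matrix viewed as a point of the Euclidean (Frobenius) space of its entries. -/
noncomputable def toEuc {n : ℕ} (M : NMatrix n) :
    EuclideanSpace ℂ (QubitBasis n × QubitBasis n) := WithLp.toLp 2 fun p => M p.1 p.2

/-- The Frobenius norm `‖X‖_F = (tr (X† X))^{1/2}` of an `n`-qubit matrix. -/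
noncomputable def frobNorm {n : ℕ} (M : NMatrix n) : ℝ := ‖toEuc M‖

/-- The accessible dimension `d_A` of an architecture `A`: the Hausdorff dimension of the
set `U(A)` of unitaries implementable with `A`, with respect to the Frobenius metric. -/
noncomputable def accessibleDim {n R : ℕ} (A : Architecture n R) : ℝ≥0∞ :=
  dimH (toEuc '' Set.range (contract A))

/-! ## Pauli strings and Clifford gates -/

/-- The Pauli matrices `1, X, Y, Z`. -/
noncomputable def pauli : Fin 4 → Matrix (Fin 2) (Fin 2) ℂ
  | 0 => 1
  | 1 => !![0, 1; 1, 0]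
  | 2 => !![0, -Complex.I; Complex.I, 0]
  | 3 => !![1, 0; 0, -1]

/-- The `n`-qubit Pauli string `⨂ᵢ pauli (s i)`. -/
noncomputable def pauliString {n : ℕ} (s : Fin n → Fin 4) : NMatrix n :=
  fun a b => ∏ i, pauli (s i) (a i) (b i)

/-- A two-qubit Pauli string, as a `4 × 4` matrix. -/
noncomputable def pauli2 (s : Fin 2 → Fin 4) : Matrix (Fin 4) (Fin 4) ℂ :=
  fun a b =>
    pauli (s 0) ⟨a.val / 2, by have := a.isLt; omega⟩ ⟨b.val / 2, by have := b.isLt; omega⟩ *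
    pauli (s 1) ⟨a.val % 2, by have := a.isLt; omega⟩ ⟨b.val % 2, by have := b.isLt; omega⟩

/-- A two-qubit gate is Clifford if it maps every Pauli string to a scalar multiple of a
Pauli string under conjugation. -/
def IsCliffordGate (u : Matrix (Fin 4) (Fin 4) ℂ) : Prop :=
  ∀ s : Fin 2 → Fin 4, ∃ (c : ℂ) (s' : Fin 2 → Fin 4),
    u * pauli2 s * uᴴ = c • pauli2 s'

/-- Application to the state `|0^n⟩`, `M ↦ M |0^n⟩`, as a real-linear map. -/
noncomputable def mulVecKet0 (n : ℕ) : NMatrix n →ₗ[ℝ] (QubitBasis n → ℂ) where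
  toFun M := M *ᵥ ket0 n
  map_add' M N := Matrix.add_mulVec M N (ket0 n)
  map_smul' r M := by
    simp only [RingHom.id_apply]
    exact Matrix.smul_mulVec r M (ket0 n)

/-- The rank of (the differential of) the map `G^A : x ↦ F^A(x)|0^n⟩` at `x`. -/
noncomputable def stateRankAt {n R : ℕ} (A : Architecture n R) (x : Fin R → SU4) : ℕ :=
  Module.finrank ℝ
    ↥(Submodule.map ((mulVecKet0 n) ∘ₗ contractDiff A x)
      (Submodule.pi Set.univ fun _ => suAlgebra (Fin 4)))

/-! ## Trace norm and operator norm -/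

/-- The positive semidefinite square root of a positive semidefinite matrix (the definition
formerly in Mathlib). -/
noncomputable def Matrix.PosSemidef.sqrt {n 𝕜 : Type*} [Fintype n] [RCLike 𝕜] [DecidableEq n]
    {A : Matrix n n 𝕜} (hA : Matrix.PosSemidef A) : Matrix n n 𝕜 :=
  hA.1.eigenvectorUnitary.1 * Matrix.diagonal ((↑) ∘ Real.sqrt ∘ hA.1.eigenvalues) *
    (star hA.1.eigenvectorUnitary : Matrix n n 𝕜)

/-- The trace norm `‖M‖₁ = tr ((M† M)^{1/2})` of a square complex matrix. -/
noncomputable def traceNorm {m : Type*} [Fintype m] [DecidableEq m] (M : Matrix m m ℂ) : ℝ :=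
  ((Matrix.posSemidef_conjTranspose_mul_self M).sqrt.trace).re

/-- The operator norm (largest singular value) of a square complex matrix: the norm of the
induced operator between Euclidean spaces. -/
noncomputable def opNorm {m : Type*} [Fintype m] [DecidableEq m] (M : Matrix m m ℂ) : ℝ :=
  ‖LinearMap.toContinuousLinearMap (Matrix.toEuclideanLin M)‖

/-! ## The uniform measure on a finite index set -/

/-- The uniform probability measure on `Fin m`. -/
noncomputable def uniformFin (m : ℕ) : Measure (Fin m) :=
  ((m : ℝ≥0∞))⁻¹ • Measure.count

instance (m : ℕ) : IsFiniteMeasure (uniformFin m) := by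
  constructor
  rw [uniformFin, Measure.smul_apply, smul_eq_mul, Measure.count_univ, ENat.card_eq_coe_fintype_card,
    Fintype.card_fin, ENat.toENNReal_coe]
  rcases Nat.eq_zero_or_pos m with h | h
  · simp [h]
  · rw [ENNReal.inv_mul_cancel (by exact_mod_cast h.ne') (by simp)]
    exact ENNReal.one_lt_top


namespace CP
noncomputable section

def k2 (A B : Matrix (Fin 2) (Fin 2) ℂ) : Matrix (Fin 4) (Fin 4) ℂ :=
  fun a b =>
    A ⟨a.val / 2, by have := a.isLt; omega⟩ ⟨b.val / 2, by have := b.isLt; omega⟩ *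
    B ⟨a.val % 2, by have := a.isLt; omega⟩ ⟨b.val % 2, by have := b.isLt; omega⟩

theorem pauli2_eq (s : Fin 2 → Fin 4) : pauli2 s = k2 (pauli (s 0)) (pauli (s 1)) := rfl

theorem k2_mul (A B C D : Matrix (Fin 2) (Fin 2) ℂ) :
    k2 A B * k2 C D = k2 (A * C) (B * D) := by
  ext a b
  rw [Matrix.mul_apply, Fin.sum_univ_four]
  change A _ 0 * B _ 0 * (C 0 _ * D 0 _) + A _ 0 * B _ 1 * (C 0 _ * D 1 _) +
    A _ 1 * B _ 0 * (C 1 _ * D 0 _) + A _ 1 * B _ 1 * (C 1 _ * D 1 _) = (A * C) _ _ * (B * D) _ _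
  rw [Matrix.mul_apply, Matrix.mul_apply, Fin.sum_univ_two, Fin.sum_univ_two]
  ring

theorem k2_smul (c d : ℂ) (A B : Matrix (Fin 2) (Fin 2) ℂ) :
    k2 (c • A) (d • B) = (c * d) • k2 A B := by
  ext a b
  simp only [k2, Matrix.smul_apply, smul_eq_mul]
  ring

theorem k2_one : k2 1 1 = 1 := by
  ext a b
  fin_cases a <;> fin_cases b <;> simp [k2, Matrix.one_apply]

def IsSgn (e : ℂ) : Prop := e = 1 ∨ e = -1

theorem IsSgn.mul {a b : ℂ} (ha : IsSgn a) (hb : IsSgn b) : IsSgn (a * b) := by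
  rcases ha with rfl | rfl <;> rcases hb with rfl | rfl <;> simp [IsSgn]

theorem pauli_mul (a b : Fin 4) :
    (∃ c, pauli a * pauli b = pauli c ∧ pauli b * pauli a = pauli c) ∨
    (∃ c e, c ≠ 0 ∧ IsSgn e ∧ pauli a * pauli b = (e * Complex.I) • pauli c ∧
      pauli b * pauli a = (-e * Complex.I) • pauli c) := by
  by_cases ha : a = 0
  · subst ha; exact Or.inl ⟨b, by simp [pauli], by simp [pauli]⟩
  by_cases hb : b = 0
  · subst hb; exact Or.inl ⟨a, by simp [pauli], by simp [pauli]⟩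
  by_cases hab : a = b
  · subst hab
    left; refine ⟨0, ?_, ?_⟩ <;>
    · ext i j
      fin_cases a <;> fin_cases i <;> fin_cases j <;>
        simp [pauli, Matrix.mul_apply, Fin.sum_univ_two] at *
  right
  have key : ∀ (a b c : Fin 4) (e : ℂ), ((a, b, c) = (1, 2, 3) ∨ (a, b, c) = (2, 3, 1) ∨ (a, b, c) = (3, 1, 2)) →
      pauli a * pauli b = (1 * Complex.I) • pauli c ∧
      pauli b * pauli a = (-1 * Complex.I) • pauli c := by
    intro a b c e h
    rcases h with h | h | h <;> (simp only [Prod.mk.injEq] at h; obtain ⟨rfl, rfl, rfl⟩ := h) <;>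
    · constructor <;>
      · ext i j
        fin_cases i <;> fin_cases j <;>
          simp [pauli, Matrix.mul_apply, Fin.sum_univ_two]
  have key2 : ∀ (a b : Fin 4), a ≠ 0 → b ≠ 0 → a ≠ b → ∃ c : Fin 4, c ≠ 0 ∧
     (((a, b, c) = (1, 2, 3) ∨ (a, b, c) = (2, 3, 1) ∨ (a, b, c) = (3, 1, 2)) ∨
     ((b, a, c) = (1, 2, 3) ∨ (b, a, c) = (2, 3, 1) ∨ (b, a, c) = (3, 1, 2))) := by decide
  obtain ⟨c, hc, h | h⟩ := key2 a b ha hb hab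
  · exact ⟨c, 1, hc, Or.inl rfl, key a b c 1 h⟩
  · refine ⟨c, -1, hc, Or.inr rfl, (key b a c 1 h).2, ?_⟩
    rw [neg_neg]; exact (key b a c 1 h).1

theorem pauli_sq (a : Fin 4) : pauli a * pauli a = 1 := by
  ext i j
  fin_cases a <;> fin_cases i <;> fin_cases j <;>
    simp [pauli, Matrix.mul_apply, Fin.sum_univ_two]

theorem pauli_anti (a : Fin 4) (ha : a ≠ 0) : ∃ d c e, d ≠ 0 ∧ c ≠ 0 ∧ IsSgn e ∧
    pauli d * pauli a = (e * Complex.I) • pauli c ∧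
      pauli a * pauli d = (-e * Complex.I) • pauli c := by
  obtain ⟨d, hd, hne⟩ : ∃ d : Fin 4, d ≠ 0 ∧ d ≠ a := by revert a; decide
  rcases pauli_mul d a with ⟨c, h1, h2⟩ | ⟨c, e, hc, he, h1, h2⟩
  · exfalso
    have h : pauli d * pauli a = pauli a * pauli d := h1.trans h2.symm
    fin_cases a <;> fin_cases d <;>
     first
     | (simp at ha; done)
     | (simp at hd; done)
     | (simp at hne; done)
     | (have h0 := congrFun (congrFun h 0) 0
        norm_num [pauli, Matrix.mul_apply, Fin.sum_univ_two, Complex.ext_iff] at h0; done)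
     | (have h1 := congrFun (congrFun h 0) 1
        norm_num [pauli, Matrix.mul_apply, Fin.sum_univ_two, Complex.ext_iff] at h1; done)
  · exact ⟨d, c, e, hd, hc, he, h1, h2⟩

theorem pauli2_sq (s : Fin 2 → Fin 4) : pauli2 s * pauli2 s = 1 := by
  rw [pauli2_eq, k2_mul, pauli_sq, pauli_sq, k2_one]

theorem pauli_herm (a : Fin 4) (i j : Fin 2) : star (pauli a j i) = pauli a i j := by
  fin_cases a <;> fin_cases i <;> fin_cases j <;> simp [pauli]

theorem pauli2_herm (s : Fin 2 → Fin 4) : (pauli2 s)ᴴ = pauli2 s := by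
  ext a b
  simp only [Matrix.conjTranspose_apply, pauli2, star_mul', pauli_herm]

theorem pauli_trace (a : Fin 4) (ha : a ≠ 0) : pauli a 0 0 + pauli a 1 1 = 0 := by
  fin_cases a <;> simp [pauli] at *

theorem pauli2_trace (s : Fin 2 → Fin 4) (hs : s ≠ 0) : (pauli2 s).trace = 0 := by
  have : (pauli2 s).trace = (pauli (s 0) 0 0 + pauli (s 0) 1 1) * (pauli (s 1) 0 0 + pauli (s 1) 1 1) := by
    rw [Matrix.trace, Fin.sum_univ_four]
    change pauli (s 0) 0 0 * pauli (s 1) 0 0 + pauli (s 0) 0 0 * pauli (s 1) 1 1 +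
      pauli (s 0) 1 1 * pauli (s 1) 0 0 + pauli (s 0) 1 1 * pauli (s 1) 1 1 = _
    ring
  rw [this]
  by_cases h0 : s 0 = 0
  · have h1 : s 1 ≠ 0 := by
      intro h1; apply hs; ext i; fin_cases i <;> simp [h0, h1]
    rw [pauli_trace _ h1, mul_zero]
  · rw [pauli_trace _ h0, zero_mul]

/-- product of two-qubit Paulis. -/
theorem pauli2_mul (r s : Fin 2 → Fin 4) :
    (pauli2 r * pauli2 s = pauli2 s * pauli2 r) ∨
    (pauli2 r * pauli2 s = -(pauli2 s * pauli2 r) ∧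
      ∃ s' e, s' ≠ 0 ∧ IsSgn e ∧ Complex.I • (pauli2 r * pauli2 s) = e • pauli2 s') := by
  simp only [pauli2_eq, k2_mul]
  rcases pauli_mul (r 0) (s 0) with ⟨c, h1, h2⟩ | ⟨c, e, hc, he, h1, h2⟩ <;>
  rcases pauli_mul (r 1) (s 1) with ⟨d, h3, h4⟩ | ⟨d, f, hd, hf, h3, h4⟩
  · left; rw [h1, h2, h3, h4]
  · right
    rw [h1, h2, h3, h4]
    have := k2_smul 1 (f * Complex.I) (pauli c) (pauli d)
    have h' := k2_smul 1 (-f * Complex.I) (pauli c) (pauli d)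
    rw [one_smul, one_mul] at this h'
    rw [this, h']
    refine ⟨by rw [← neg_smul]; congr 1; ring, ![c, d], -f, ?_, ?_, ?_⟩
    · intro h; exact hd (congrFun h 1)
    · rcases hf with rfl | rfl <;> simp [IsSgn]
    · rw [smul_smul]; congr 1; linear_combination f * Complex.I_mul_I
  · right
    rw [h1, h2, h3, h4]
    have := k2_smul (e * Complex.I) 1 (pauli c) (pauli d)
    have h' := k2_smul (-e * Complex.I) 1 (pauli c) (pauli d)
    rw [one_smul, mul_one] at this h'
    rw [this, h']
    refine ⟨by rw [← neg_smul]; congr 1; ring, ![c, d], -e, ?_, ?_, ?_⟩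
    · intro h; exact hc (congrFun h 0)
    · rcases he with rfl | rfl <;> simp [IsSgn]
    · rw [smul_smul]; congr 1; linear_combination e * Complex.I_mul_I
  · left; rw [h1, h2, h3, h4, k2_smul, k2_smul]; congr 1; ring

def rot (r : Fin 2 → Fin 4) : Matrix (Fin 4) (Fin 4) ℂ :=
  ((Real.sqrt 2 : ℂ)⁻¹) • (1 + Complex.I • pauli2 r)

theorem sq2 : ((Real.sqrt 2 : ℂ)⁻¹) * ((Real.sqrt 2 : ℂ)⁻¹) = 1 / 2 := by
  rw [← mul_inv, ← Complex.ofReal_mul, Real.mul_self_sqrt (by norm_num)]; norm_num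

theorem rot_unitary (r : Fin 2 → Fin 4) : rot r ∈ Matrix.unitaryGroup (Fin 4) ℂ := by
  rw [Matrix.mem_unitaryGroup_iff, Matrix.star_eq_conjTranspose, rot, Matrix.conjTranspose_smul,
    Matrix.conjTranspose_add, Matrix.conjTranspose_smul, pauli2_herm, Matrix.conjTranspose_one]
  have h : star ((Real.sqrt 2 : ℂ)⁻¹) = (Real.sqrt 2 : ℂ)⁻¹ := by
    simp
  rw [h, Matrix.smul_mul, Matrix.mul_smul, smul_smul, sq2]
  simp only [add_mul, mul_add, one_mul, mul_one, Matrix.smul_mul, Matrix.mul_smul, pauli2_sq, smul_smul]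
  simp
  module

theorem exists_anti (r : Fin 2 → Fin 4) (hr : r ≠ 0) :
    ∃ s, pauli2 r * pauli2 s = -(pauli2 s * pauli2 r) := by
  by_cases h0 : r 0 = 0
  · have h1 : r 1 ≠ 0 := by
      intro h1; apply hr; ext i; fin_cases i <;> simp [h0, h1]
    obtain ⟨d, c, e, hd, hc, he, h1, h2⟩ := pauli_anti (r 1) h1
    refine ⟨![0, d], ?_⟩
    rw [pauli2_eq, pauli2_eq, k2_mul, k2_mul]
    change k2 (pauli (r 0) * 1) (pauli (r 1) * pauli d) = -k2 (1 * pauli (r 0)) (pauli d * pauli (r 1))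
    rw [h1, h2, mul_one, one_mul]
    have t1 := k2_smul 1 (e * Complex.I) (pauli (r 0)) (pauli c)
    have t2 := k2_smul 1 (-e * Complex.I) (pauli (r 0)) (pauli c)
    rw [one_smul] at t1 t2
    rw [t1, t2, ← neg_smul]; congr 1; ring
  · obtain ⟨d, c, e, hd, hc, he, h1, h2⟩ := pauli_anti (r 0) h0
    refine ⟨![d, 0], ?_⟩
    rw [pauli2_eq, pauli2_eq, k2_mul, k2_mul]
    change k2 (pauli (r 0) * pauli d) (pauli (r 1) * 1) = -k2 (pauli d * pauli (r 0)) (1 * pauli (r 1))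
    rw [h1, h2, mul_one, one_mul]
    have t1 := k2_smul (e * Complex.I) 1 (pauli c) (pauli (r 1))
    have t2 := k2_smul (-e * Complex.I) 1 (pauli c) (pauli (r 1))
    rw [one_smul] at t1 t2
    rw [t1, t2, ← neg_smul]; congr 1; ring

theorem rot_det (r : Fin 2 → Fin 4) (hr : r ≠ 0) : (rot r).det = 1 := by
  obtain ⟨s, hs⟩ := exists_anti r hr
  set c : ℂ := ((Real.cos (Real.pi / 8) : ℝ) : ℂ) with hc
  set d : ℂ := ((Real.sin (Real.pi / 8) : ℝ) : ℂ) with hd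
  have h1 : c * c + d * d = 1 := by
    have := Real.sin_sq_add_cos_sq (Real.pi / 8)
    rw [hc, hd]; norm_cast; linarith
  have h2 : c * c - d * d = (Real.sqrt 2 : ℂ)⁻¹ := by
    have := Real.cos_two_mul' (Real.pi / 8)
    rw [show 2 * (Real.pi / 8) = Real.pi / 4 by ring, Real.cos_pi_div_four, Real.sqrt_div_self'] at this
    rw [hc, hd]; norm_cast
    rw [← one_div]; linarith
  have h3 : 2 * c * d = (Real.sqrt 2 : ℂ)⁻¹ := by
    have := Real.sin_two_mul (Real.pi / 8)
    rw [show 2 * (Real.pi / 8) = Real.pi / 4 by ring, Real.sin_pi_div_four, Real.sqrt_div_self'] at this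
    rw [hc, hd]; norm_cast
    rw [← one_div]; linarith
  set w : Matrix (Fin 4) (Fin 4) ℂ := c • 1 + (d * Complex.I) • pauli2 r with hw
  set w' : Matrix (Fin 4) (Fin 4) ℂ := c • 1 - (d * Complex.I) • pauli2 r with hw'
  have e1 : w * w = rot r := by
    simp only [hw, rot, add_mul, mul_add, Matrix.smul_mul, Matrix.mul_smul, one_mul, mul_one, pauli2_sq,
      smul_add, smul_smul, ← h2]
    rw [h2, ← h3]
    have : d * Complex.I * (d * Complex.I) = - (d * d) := by linear_combination d * d * Complex.I_mul_I
    rw [this, h3, ← h2]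
    match_scalars
    · ring
    · linear_combination Complex.I * (h3 - h2)
  have e2 : w * w' = 1 := by
    simp only [hw, hw', add_mul, mul_sub, Matrix.smul_mul, Matrix.mul_smul, one_mul, mul_one, pauli2_sq,
      smul_sub, smul_smul]
    match_scalars
    · linear_combination h1 - d * d * Complex.I_mul_I
    · ring
  have e3 : w * pauli2 s = pauli2 s * w' := by
    simp only [hw, hw', add_mul, mul_sub, Matrix.smul_mul, Matrix.mul_smul, one_mul, mul_one, hs]
    simp [sub_eq_add_neg]
  have hdet : (pauli2 s).det * (pauli2 s).det = 1 := by
    rw [← Matrix.det_mul, pauli2_sq, Matrix.det_one]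
  have d1 := congrArg Matrix.det e2
  have d2 := congrArg Matrix.det e3
  rw [Matrix.det_mul] at d1 d2
  rw [Matrix.det_mul] at d2
  rw [Matrix.det_one] at d1
  rw [← e1, Matrix.det_mul]
  linear_combination d1 + w.det * (pauli2 s).det * d2 + w.det * (w'.det - w.det) * hdet

theorem rot_comm (r : Fin 2 → Fin 4) (S : Matrix (Fin 4) (Fin 4) ℂ) (h : pauli2 r * S = S * pauli2 r) :
    rot r * S = S * rot r := by
  simp only [rot, add_mul, mul_add, one_mul, mul_one, Matrix.smul_mul, Matrix.mul_smul, h]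

theorem rot_anti (r : Fin 2 → Fin 4) (S : Matrix (Fin 4) (Fin 4) ℂ) (h : pauli2 r * S = -(S * pauli2 r)) :
    rot r * S = (Complex.I • (pauli2 r * S)) * rot r := by
  have h2 : pauli2 r * S * pauli2 r = - S := by
    rw [h, neg_mul, mul_assoc, pauli2_sq, mul_one]
  simp only [rot, add_mul, mul_add, one_mul, mul_one, Matrix.smul_mul, Matrix.mul_smul, h2, smul_smul,
    Complex.I_mul_I]
  simp [add_comm]

/-- strong Clifford property. -/
def Good (u : Matrix (Fin 4) (Fin 4) ℂ) : Prop :=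
  ∀ s : Fin 2 → Fin 4, ∃ (e : ℂ) (s' : Fin 2 → Fin 4), IsSgn e ∧ (s ≠ 0 → s' ≠ 0) ∧
    u * pauli2 s = e • (pauli2 s' * u)

theorem Good.clifford {u : Matrix (Fin 4) (Fin 4) ℂ} (h : Good u) (hu : u * uᴴ = 1) : IsCliffordGate u := by
  intro s
  obtain ⟨e, s', -, -, h⟩ := h s
  refine ⟨e, s', ?_⟩
  rw [h, Matrix.smul_mul, mul_assoc, hu, mul_one]

theorem Good.mul {u v : Matrix (Fin 4) (Fin 4) ℂ} (hu : Good u) (hv : Good v) : Good (u * v) := by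
  intro s
  obtain ⟨e, s', he, hs, h⟩ := hv s
  obtain ⟨e', s'', he', hs', h'⟩ := hu s'
  refine ⟨e * e', s'', he.mul he', fun q => hs' (hs q), ?_⟩
  rw [mul_assoc, h, Matrix.mul_smul, ← mul_assoc, h', Matrix.smul_mul, smul_smul, mul_assoc]

theorem good_one : Good 1 := fun s => ⟨1, s, Or.inl rfl, id, by simp⟩

theorem good_rot (r : Fin 2 → Fin 4) : Good (rot r) := by
  intro s
  rcases pauli2_mul r s with h | ⟨h, s', e, hs', he, h2⟩
  · exact ⟨1, s, Or.inl rfl, id, by rw [rot_comm r _ h, one_smul]⟩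
  · exact ⟨e, s', he, fun _ => hs', by rw [rot_anti r _ h, h2, Matrix.smul_mul]⟩

theorem move_aux (a b : Fin 4) (ha : a ≠ 0) : ∃ r : Fin 2 → Fin 4, r ≠ 0 ∧ ∃ e c, IsSgn e ∧ c ≠ 0 ∧
    rot r * k2 (pauli a) (pauli b) = e • (k2 (pauli c) (pauli 0) * rot r) := by
  obtain ⟨d, c, e, hd, hc, he, h1, h2⟩ := pauli_anti a ha
  have H1 : pauli2 ![d, b] * k2 (pauli a) (pauli b) = (e * Complex.I) • k2 (pauli c) (pauli 0) := by
    rw [pauli2_eq, k2_mul]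
    have := k2_smul (e * Complex.I) 1 (pauli c) (pauli 0)
    rw [one_smul, mul_one] at this
    rw [← this]; congr 1; exact pauli_sq b
  have H2 : k2 (pauli a) (pauli b) * pauli2 ![d, b] = (-e * Complex.I) • k2 (pauli c) (pauli 0) := by
    rw [pauli2_eq, k2_mul]
    have := k2_smul (-e * Complex.I) 1 (pauli c) (pauli 0)
    rw [one_smul, mul_one] at this
    rw [← this]; congr 1; exact pauli_sq b
  refine ⟨![d, b], fun h => hd (congrFun h 0), -e, c, ?_, hc, ?_⟩
  · rcases he with rfl | rfl <;> simp [IsSgn]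
  · rw [rot_anti, H1, smul_smul, Matrix.smul_mul]
    · congr 1; linear_combination e * Complex.I_mul_I
    · rw [H1, H2, ← neg_smul]; congr 1; ring

theorem move_aux' (a b : Fin 4) (hb : b ≠ 0) : ∃ r : Fin 2 → Fin 4, r ≠ 0 ∧ ∃ e c, IsSgn e ∧ c ≠ 0 ∧
    rot r * k2 (pauli a) (pauli b) = e • (k2 (pauli 0) (pauli c) * rot r) := by
  obtain ⟨d, c, e, hd, hc, he, h1, h2⟩ := pauli_anti b hb
  have H1 : pauli2 ![a, d] * k2 (pauli a) (pauli b) = (e * Complex.I) • k2 (pauli 0) (pauli c) := by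
    rw [pauli2_eq, k2_mul]
    have := k2_smul 1 (e * Complex.I) (pauli 0) (pauli c)
    rw [one_smul, one_mul] at this
    rw [← this]; congr 1; exact pauli_sq a
  have H2 : k2 (pauli a) (pauli b) * pauli2 ![a, d] = (-e * Complex.I) • k2 (pauli 0) (pauli c) := by
    rw [pauli2_eq, k2_mul]
    have := k2_smul 1 (-e * Complex.I) (pauli 0) (pauli c)
    rw [one_smul, one_mul] at this
    rw [← this]; congr 1; exact pauli_sq a
  refine ⟨![a, d], fun h => hd (congrFun h 1), -e, c, ?_, hc, ?_⟩
  · rcases he with rfl | rfl <;> simp [IsSgn]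
  · rw [rot_anti, H1, smul_smul, Matrix.smul_mul]
    · congr 1; linear_combination e * Complex.I_mul_I
    · rw [H1, H2, ← neg_smul]; congr 1; ring

/-- spreading `(0,b)` to `(1,c)`. -/
theorem spread_aux (b : Fin 4) (hb : b ≠ 0) : ∃ r : Fin 2 → Fin 4, r ≠ 0 ∧ ∃ e c, IsSgn e ∧ c ≠ 0 ∧
    rot r * k2 (pauli 0) (pauli b) = e • (k2 (pauli 1) (pauli c) * rot r) := by
  obtain ⟨d, c, e, hd, hc, he, h1, h2⟩ := pauli_anti b hb
  have H1 : pauli2 ![1, d] * k2 (pauli 0) (pauli b) = (e * Complex.I) • k2 (pauli 1) (pauli c) := by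
    rw [pauli2_eq, k2_mul]
    have := k2_smul 1 (e * Complex.I) (pauli 1) (pauli c)
    rw [one_smul, one_mul] at this
    rw [← this]; congr 1; exact mul_one _
  have H2 : k2 (pauli 0) (pauli b) * pauli2 ![1, d] = (-e * Complex.I) • k2 (pauli 1) (pauli c) := by
    rw [pauli2_eq, k2_mul]
    have := k2_smul 1 (-e * Complex.I) (pauli 1) (pauli c)
    rw [one_smul, one_mul] at this
    rw [← this]; congr 1; exact one_mul _
  refine ⟨![1, d], fun h => hd (congrFun h 1), -e, c, ?_, hc, ?_⟩
  · rcases he with rfl | rfl <;> simp [IsSgn]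
  · rw [rot_anti, H1, smul_smul, Matrix.smul_mul]
    · congr 1; linear_combination e * Complex.I_mul_I
    · rw [H1, H2, ← neg_smul]; congr 1; ring

theorem spread_aux' (a : Fin 4) (ha : a ≠ 0) : ∃ r : Fin 2 → Fin 4, r ≠ 0 ∧ ∃ e c, IsSgn e ∧ c ≠ 0 ∧
    rot r * k2 (pauli a) (pauli 0) = e • (k2 (pauli c) (pauli 1) * rot r) := by
  obtain ⟨d, c, e, hd, hc, he, h1, h2⟩ := pauli_anti a ha
  have H1 : pauli2 ![d, 1] * k2 (pauli a) (pauli 0) = (e * Complex.I) • k2 (pauli c) (pauli 1) := by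
    rw [pauli2_eq, k2_mul]
    have := k2_smul (e * Complex.I) 1 (pauli c) (pauli 1)
    rw [one_smul, mul_one] at this
    rw [← this]; congr 1; exact mul_one _
  have H2 : k2 (pauli a) (pauli 0) * pauli2 ![d, 1] = (-e * Complex.I) • k2 (pauli c) (pauli 1) := by
    rw [pauli2_eq, k2_mul]
    have := k2_smul (-e * Complex.I) 1 (pauli c) (pauli 1)
    rw [one_smul, mul_one] at this
    rw [← this]; congr 1; exact one_mul _
  refine ⟨![d, 1], fun h => hd (congrFun h 0), -e, c, ?_, hc, ?_⟩
  · rcases he with rfl | rfl <;> simp [IsSgn]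
  · rw [rot_anti, H1, smul_smul, Matrix.smul_mul]
    · congr 1; linear_combination e * Complex.I_mul_I
    · rw [H1, H2, ← neg_smul]; congr 1; ring

def rotS (r : Fin 2 → Fin 4) (hr : r ≠ 0) : SU4 :=
  ⟨rot r, Matrix.mem_specialUnitaryGroup_iff.mpr ⟨rot_unitary r, rot_det r hr⟩⟩

abbrev GoodS (u : SU4) : Prop := Good (u : Matrix (Fin 4) (Fin 4) ℂ)

/-- Any nontrivial Pauli can be moved onto either qubit. -/
theorem move (f : Fin 2) (a b : Fin 4) (h : a ≠ 0 ∨ b ≠ 0) :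
    ∃ u : SU4, GoodS u ∧ ∃ e c d, IsSgn e ∧ (f = 0 → c ≠ 0 ∧ d = 0) ∧ (f = 1 → c = 0 ∧ d ≠ 0) ∧
    u.1 * k2 (pauli a) (pauli b) = e • (k2 (pauli c) (pauli d) * u.1) := by
  fin_cases f
  · by_cases ha : a = 0
    · have hb : b ≠ 0 := by tauto
      subst ha
      obtain ⟨r, hr, e, c, he, hc, h⟩ := spread_aux b hb
      obtain ⟨r', hr', e', c', he', hc', h'⟩ := move_aux 1 c (by decide)
      refine ⟨rotS r' hr' * rotS r hr, (good_rot r').mul (good_rot r), e * e', c', 0, he.mul he',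
        by simp [hc'], by simp, ?_⟩
      change rot r' * rot r * _ = (e * e') • (_ * (rot r' * rot r))
      rw [mul_assoc, h, Matrix.mul_smul, ← mul_assoc, h', Matrix.smul_mul, smul_smul, mul_assoc]
    · obtain ⟨r', hr', e', c', he', hc', h'⟩ := move_aux a b ha
      exact ⟨rotS r' hr', good_rot r', e', c', 0, he', by simp [hc'], by simp, h'⟩
  · by_cases hb : b = 0
    · have ha : a ≠ 0 := by tauto
      subst hb
      obtain ⟨r, hr, e, c, he, hc, h⟩ := spread_aux' a ha
      obtain ⟨r', hr', e', c', he', hc', h'⟩ := move_aux' c 1 (by decide)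
      refine ⟨rotS r' hr' * rotS r hr, (good_rot r').mul (good_rot r), e * e', 0, c', he.mul he',
        by simp, by simp [hc'], ?_⟩
      change rot r' * rot r * _ = (e * e') • (_ * (rot r' * rot r))
      rw [mul_assoc, h, Matrix.mul_smul, ← mul_assoc, h', Matrix.smul_mul, smul_smul, mul_assoc]
    · obtain ⟨r', hr', e', c', he', hc', h'⟩ := move_aux' a b hb
      exact ⟨rotS r' hr', good_rot r', e', 0, c', he', by simp, by simp [hc'], h'⟩

end
end CP

namespace CP
noncomputable section

def rest {n : ℕ} (p : Fin n × Fin n) (σ : Fin n → Fin 4) (a b : QubitBasis n) : ℂ :=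
  ∏ i ∈ (Finset.univ.erase p.1).erase p.2, pauli (σ i) (a i) (b i)

def loc {n : ℕ} (p : Fin n × Fin n) (a : QubitBasis n) : Fin 4 := pairIdx (a p.1) (a p.2)

def upd {n : ℕ} (p : Fin n × Fin n) (a : QubitBasis n) (c d : Fin 2) : QubitBasis n :=
  Function.update (Function.update a p.1 c) p.2 d

def res {n : ℕ} (p : Fin n × Fin n) (σ : Fin n → Fin 4) : Fin 2 → Fin 4 := ![σ p.1, σ p.2]

theorem pauli2_pair (s : Fin 2 → Fin 4) (a b c d : Fin 2) :
    pauli2 s (pairIdx a b) (pairIdx c d) = pauli (s 0) a c * pauli (s 1) b d := by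
  fin_cases a <;> fin_cases b <;> fin_cases c <;> fin_cases d <;> rfl

theorem sum_pair (g : Fin 4 → ℂ) : ∑ k, g k = ∑ c, ∑ d, g (pairIdx c d) := by
  rw [Fin.sum_univ_four, Fin.sum_univ_two, Fin.sum_univ_two, Fin.sum_univ_two, ← add_assoc]; rfl

theorem ps_split {n : ℕ} (p : Fin n × Fin n) (hp : p.1 ≠ p.2) (σ : Fin n → Fin 4) (a b : QubitBasis n) :
    pauliString σ a b = pauli2 (res p σ) (loc p a) (loc p b) * rest p σ a b := by
  rw [loc, loc, pauli2_pair, pauliString, rest]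
  rw [← Finset.mul_prod_erase Finset.univ _ (Finset.mem_univ p.1),
    ← Finset.mul_prod_erase (Finset.univ.erase p.1) _ (a := p.2) (by simp [hp.symm]), mul_assoc]
  rfl

theorem sum_agree {n : ℕ} (p : Fin n × Fin n) (hp : p.1 ≠ p.2) (a : QubitBasis n) (f : QubitBasis n → ℂ) :
    (∑ k, if (∀ i, i ≠ p.1 → i ≠ p.2 → a i = k i) then f k else 0) = ∑ c, ∑ d, f (upd p a c d) := by
  rw [← Finset.sum_filter, ← Finset.sum_product']
  symm
  apply Finset.sum_nbij' (i := fun x : Fin 2 × Fin 2 => upd p a x.1 x.2) (j := fun k => (k p.1, k p.2))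
  · intro x _
    simp only [Finset.mem_filter, Finset.mem_univ, true_and]
    intro i h1 h2
    simp [upd, Function.update_of_ne h1, Function.update_of_ne h2]
  · intro x _; simp
  · intro x _
    simp [upd, Function.update_of_ne hp]
  · intro k hk
    simp only [Finset.mem_filter, Finset.mem_univ, true_and] at hk
    ext i
    by_cases h2 : i = p.2
    · subst h2; simp [upd]
    · by_cases h1 : i = p.1
      · subst h1; simp [upd, Function.update_of_ne hp]
      · simp [upd, Function.update_of_ne h1, Function.update_of_ne h2, hk i h1 h2]
  · intro x _; rfl

theorem loc_upd {n : ℕ} (p : Fin n × Fin n) (hp : p.1 ≠ p.2) (a : QubitBasis n) (c d : Fin 2) :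
    loc p (upd p a c d) = pairIdx c d := by
  simp [loc, upd, Function.update_of_ne hp]

theorem upd_other {n : ℕ} (p : Fin n × Fin n) (a : QubitBasis n) (c d : Fin 2) (i : Fin n)
    (h1 : i ≠ p.1) (h2 : i ≠ p.2) : upd p a c d i = a i := by
  simp [upd, Function.update_of_ne h1, Function.update_of_ne h2]

theorem rest_upd_left {n : ℕ} (p : Fin n × Fin n) (σ : Fin n → Fin 4) (a b : QubitBasis n) (c d : Fin 2) :
    rest p σ (upd p a c d) b = rest p σ a b := by
  apply Finset.prod_congr rfl
  intro i hi
  simp at hi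
  rw [upd_other p a c d i hi.2 hi.1]

theorem rest_upd_right {n : ℕ} (p : Fin n × Fin n) (σ : Fin n → Fin 4) (a b : QubitBasis n) (c d : Fin 2) :
    rest p σ a (upd p b c d) = rest p σ a b := by
  apply Finset.prod_congr rfl
  intro i hi
  simp at hi
  rw [upd_other p b c d i hi.2 hi.1]

theorem embed_apply {n : ℕ} (p : Fin n × Fin n) (u : Matrix (Fin 4) (Fin 4) ℂ) (a b : QubitBasis n) :
    embedGate p u a b = if (∀ i, i ≠ p.1 → i ≠ p.2 → a i = b i) then u (loc p a) (loc p b) else 0 := by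
  rw [embedGate]; rfl

theorem embed_mul_apply {n : ℕ} (p : Fin n × Fin n) (hp : p.1 ≠ p.2) (u : Matrix (Fin 4) (Fin 4) ℂ)
    (M : NMatrix n) (a b : QubitBasis n) :
    (embedGate p u * M) a b = ∑ c, ∑ d, u (loc p a) (pairIdx c d) * M (upd p a c d) b := by
  rw [Matrix.mul_apply]
  have := sum_agree p hp a (fun k => u (loc p a) (loc p k) * M k b)
  simp only [loc_upd p hp] at this
  rw [← this]
  apply Finset.sum_congr rfl
  intro k _
  rw [embed_apply]
  split_ifs <;> simp

theorem mul_embed_apply {n : ℕ} (p : Fin n × Fin n) (hp : p.1 ≠ p.2) (u : Matrix (Fin 4) (Fin 4) ℂ)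
    (M : NMatrix n) (a b : QubitBasis n) :
    (M * embedGate p u) a b = ∑ c, ∑ d, M a (upd p b c d) * u (pairIdx c d) (loc p b) := by
  rw [Matrix.mul_apply]
  have := sum_agree p hp b (fun k => M a k * u (loc p k) (loc p b))
  simp only [loc_upd p hp] at this
  rw [← this]
  apply Finset.sum_congr rfl
  intro k _
  rw [embed_apply]
  by_cases h : (∀ i, i ≠ p.1 → i ≠ p.2 → b i = k i)
  · rw [if_pos h, if_pos (fun i h1 h2 => (h i h1 h2).symm)]
  · rw [if_neg h, if_neg (fun h' => h (fun i h1 h2 => (h' i h1 h2).symm)), mul_zero]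

theorem embed_mul_ps {n : ℕ} (p : Fin n × Fin n) (hp : p.1 ≠ p.2) (u : Matrix (Fin 4) (Fin 4) ℂ)
    (σ : Fin n → Fin 4) (a b : QubitBasis n) :
    (embedGate p u * pauliString σ) a b = (u * pauli2 (res p σ)) (loc p a) (loc p b) * rest p σ a b := by
  rw [embed_mul_apply p hp, Matrix.mul_apply, sum_pair, Finset.sum_mul]
  refine Finset.sum_congr rfl fun c _ => ?_
  rw [Finset.sum_mul]
  refine Finset.sum_congr rfl fun d _ => ?_
  rw [ps_split p hp, rest_upd_left, loc_upd p hp, mul_assoc]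

theorem ps_mul_embed {n : ℕ} (p : Fin n × Fin n) (hp : p.1 ≠ p.2) (u : Matrix (Fin 4) (Fin 4) ℂ)
    (σ : Fin n → Fin 4) (a b : QubitBasis n) :
    (pauliString σ * embedGate p u) a b = (pauli2 (res p σ) * u) (loc p a) (loc p b) * rest p σ a b := by
  rw [mul_embed_apply p hp, Matrix.mul_apply, sum_pair, Finset.sum_mul]
  refine Finset.sum_congr rfl fun c _ => ?_
  rw [Finset.sum_mul]
  refine Finset.sum_congr rfl fun d _ => ?_
  rw [ps_split p hp, rest_upd_right, loc_upd p hp]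
  ring

/-- Replace the two letters at `p`. -/
def repl {n : ℕ} (p : Fin n × Fin n) (σ : Fin n → Fin 4) (s : Fin 2 → Fin 4) : Fin n → Fin 4 :=
  Function.update (Function.update σ p.1 (s 0)) p.2 (s 1)

theorem repl_other {n : ℕ} (p : Fin n × Fin n) (σ : Fin n → Fin 4) (s : Fin 2 → Fin 4) (i : Fin n)
    (h1 : i ≠ p.1) (h2 : i ≠ p.2) : repl p σ s i = σ i := by
  simp [repl, Function.update_of_ne h1, Function.update_of_ne h2]

theorem repl_fst {n : ℕ} (p : Fin n × Fin n) (hp : p.1 ≠ p.2) (σ : Fin n → Fin 4) (s : Fin 2 → Fin 4) :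
    repl p σ s p.1 = s 0 := by simp [repl, Function.update_of_ne hp]

theorem repl_snd {n : ℕ} (p : Fin n × Fin n) (σ : Fin n → Fin 4) (s : Fin 2 → Fin 4) :
    repl p σ s p.2 = s 1 := by simp [repl]

theorem res_repl {n : ℕ} (p : Fin n × Fin n) (hp : p.1 ≠ p.2) (σ : Fin n → Fin 4) (s : Fin 2 → Fin 4) :
    res p (repl p σ s) = s := by
  ext i; fin_cases i <;> simp [res, repl_fst p hp, repl_snd]

theorem rest_repl {n : ℕ} (p : Fin n × Fin n) (σ : Fin n → Fin 4) (s : Fin 2 → Fin 4) (a b : QubitBasis n) :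
    rest p (repl p σ s) a b = rest p σ a b := by
  apply Finset.prod_congr rfl
  intro i hi
  simp at hi
  rw [repl_other p σ s i hi.2 hi.1]

theorem push {n : ℕ} (p : Fin n × Fin n) (hp : p.1 ≠ p.2) (u : Matrix (Fin 4) (Fin 4) ℂ)
    (σ : Fin n → Fin 4) (s' : Fin 2 → Fin 4) (e : ℂ) (h : u * pauli2 (res p σ) = e • (pauli2 s' * u)) :
    embedGate p u * pauliString σ = e • (pauliString (repl p σ s') * embedGate p u) := by
  ext a b
  rw [embed_mul_ps p hp, Matrix.smul_apply, ps_mul_embed p hp, res_repl p hp, rest_repl, h,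
    Matrix.smul_apply, smul_eq_mul, smul_eq_mul, mul_assoc]

theorem ps_eq_embed {n : ℕ} (p : Fin n × Fin n) (hp : p.1 ≠ p.2) (σ : Fin n → Fin 4)
    (h : ∀ i, σ i ≠ 0 → i = p.1 ∨ i = p.2) : pauliString σ = embedGate p (pauli2 (res p σ)) := by
  ext a b
  rw [ps_split p hp, embed_apply]
  have : rest p σ a b = if (∀ i, i ≠ p.1 → i ≠ p.2 → a i = b i) then 1 else 0 := by
    have h0 : ∀ i ∈ (Finset.univ.erase p.1).erase p.2, σ i = 0 := by
      intro i hi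
      simp at hi
      by_contra hc
      rcases h i hc with h | h
      · exact hi.2 h
      · exact hi.1 h
    rw [rest]
    split_ifs with hab
    · apply Finset.prod_eq_one
      intro i hi
      rw [h0 i hi]
      simp at hi
      rw [hab i hi.2 hi.1]
      exact Matrix.one_apply_eq _
    · push Not at hab
      obtain ⟨i, h1, h2, h3⟩ := hab
      apply Finset.prod_eq_zero (i := i) (by simp [h1, h2])
      rw [h0 i (by simp [h1, h2])]
      simp [pauli, h3]
  rw [this]
  split_ifs <;> simp

theorem embed_one {n : ℕ} (p : Fin n × Fin n) : embedGate p 1 = (1 : NMatrix n) := by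
  ext a b
  rw [embed_apply, Matrix.one_apply, Matrix.one_apply]
  have hl : ∀ a b c d : Fin 2, pairIdx a b = pairIdx c d ↔ a = c ∧ b = d := by decide
  by_cases h : a = b
  · subst h; simp
  · rw [if_neg h]
    split_ifs with h1 h2
    · exfalso
      apply h; ext i
      rw [loc, loc, hl] at h2
      by_cases i1 : i = p.1
      · rw [i1, h2.1]
      · by_cases i2 : i = p.2
        · rw [i2, h2.2]
        · rw [h1 i i1 i2]
    · rfl
    · rfl

theorem embed_mul {n : ℕ} (p : Fin n × Fin n) (hp : p.1 ≠ p.2) (u v : Matrix (Fin 4) (Fin 4) ℂ) :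
    embedGate p u * embedGate p v = (embedGate p (u * v) : NMatrix n) := by
  ext a b
  rw [embed_mul_apply p hp, embed_apply, Matrix.mul_apply, sum_pair]
  simp only [embed_apply, loc_upd p hp]
  have : ∀ c d, (∀ i, i ≠ p.1 → i ≠ p.2 → upd p a c d i = b i) ↔ (∀ i, i ≠ p.1 → i ≠ p.2 → a i = b i) := by
    intro c d
    refine forall_congr' fun i => forall_congr' fun h1 => forall_congr' fun h2 => ?_
    rw [upd_other p a c d i h1 h2]
  simp only [this]
  split_ifs <;> simp

/-! ### the circuit, indexed by naturals -/

abbrev Pr (n : ℕ) := {p : Fin n × Fin n // p.1 ≠ p.2}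

def W {n : ℕ} (p : ℕ → Pr n) (x : ℕ → SU4) : ℕ → NMatrix n
  | 0 => 1
  | k + 1 => embedGate (p k).1 (x k).1 * W p x k

theorem W_congr {n : ℕ} (p : ℕ → Pr n) (x y : ℕ → SU4) (k : ℕ) (h : ∀ i < k, x i = y i) :
    W p x k = W p y k := by
  induction k with
  | zero => rfl
  | succ k ih =>
    rw [W, W, ih (fun i hi => h i (by omega)), h k (by omega)]

theorem W_inv {n : ℕ} (p : ℕ → Pr n) (x : ℕ → SU4) (k : ℕ) : ∃ V, V * W p x k = 1 := by
  induction k with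
  | zero => exact ⟨1, by simp [W]⟩
  | succ k ih =>
    obtain ⟨V, hV⟩ := ih
    refine ⟨V * embedGate (p k).1 (star (x k).1), ?_⟩
    have hu : star (x k).1 * (x k).1 = 1 :=
      (Matrix.mem_specialUnitaryGroup_iff.mp (x k).2).1.1
    rw [W, mul_assoc, ← mul_assoc (embedGate _ _), embed_mul _ (p k).2, hu, embed_one, one_mul, hV]

/-- The Pauli string `Q` has become `± σ` after `k` gates. -/
def Tr {n : ℕ} (p : ℕ → Pr n) (x : ℕ → SU4) (Q : Fin n → Fin 4) (k : ℕ) (σ : Fin n → Fin 4) : Prop :=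
  ∃ e, IsSgn e ∧ W p x k * pauliString Q = e • (pauliString σ * W p x k)

theorem Tr.congr {n : ℕ} {p : ℕ → Pr n} {x y : ℕ → SU4} {Q : Fin n → Fin 4} {k : ℕ} {σ : Fin n → Fin 4}
    (h : Tr p x Q k σ) (hxy : ∀ i < k, x i = y i) : Tr p y Q k σ := by
  obtain ⟨e, he, h⟩ := h
  exact ⟨e, he, by rw [← W_congr p x y k hxy, h]⟩

theorem Tr.succ {n : ℕ} {p : ℕ → Pr n} {x : ℕ → SU4} {Q : Fin n → Fin 4} {k : ℕ} {σ : Fin n → Fin 4}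
    (h : Tr p x Q k σ) (s' : Fin 2 → Fin 4) (e : ℂ) (he : IsSgn e)
    (hu : (x k).1 * pauli2 (res (p k).1 σ) = e • (pauli2 s' * (x k).1)) :
    Tr p x Q (k + 1) (repl (p k).1 σ s') := by
  obtain ⟨f, hf, h⟩ := h
  refine ⟨f * e, hf.mul he, ?_⟩
  rw [W, mul_assoc, h, Matrix.mul_smul, ← mul_assoc, push _ (p k).2 _ _ _ _ hu, Matrix.smul_mul, smul_smul,
    mul_assoc]

theorem res_ne {n : ℕ} {p : Fin n × Fin n} {σ : Fin n → Fin 4} (h : σ p.1 ≠ 0 ∨ σ p.2 ≠ 0) : res p σ ≠ 0 := by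
  intro h0
  rcases h with h | h
  · exact h (congrFun h0 0)
  · exact h (congrFun h0 1)

theorem repl_ne {n : ℕ} {p : Fin n × Fin n} (hp : p.1 ≠ p.2) {σ : Fin n → Fin 4} {s : Fin 2 → Fin 4} 
    (h : s ≠ 0) : repl p σ s ≠ 0 := by
  intro h0
  apply h
  rw [← res_repl p hp σ s, h0]
  ext i; fin_cases i <;> rfl

theorem Tr.exists_all {n : ℕ} {p : ℕ → Pr n} {x : ℕ → SU4} (hx : ∀ i, GoodS (x i)) {Q : Fin n → Fin 4}
    (hQ : Q ≠ 0) (k : ℕ) : ∃ σ, σ ≠ 0 ∧ Tr p x Q k σ := by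
  induction k with
  | zero => exact ⟨Q, hQ, 1, Or.inl rfl, by simp [W]⟩
  | succ k ih =>
    obtain ⟨σ, hσ, h⟩ := ih
    obtain ⟨e, s', he, hs, hu⟩ := hx k (res (p k).1 σ)
    refine ⟨_, ?_, h.succ s' e he hu⟩
    by_cases h0 : res (p k).1 σ = 0
    · obtain ⟨i, hi⟩ := Function.ne_iff.mp hσ
      have e0 : σ (p k).1.1 = 0 := congrFun h0 0
      have e1 : σ (p k).1.2 = 0 := congrFun h0 1
      intro hz
      apply hi
      rw [← repl_other (p k).1 σ s' i, hz]
      · rintro rfl; exact hi e0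
      · rintro rfl; exact hi e1
    · exact repl_ne (p k).2 (hs h0)

def On {n : ℕ} (p : Pr n) (q : Fin n) : Prop := q = p.1.1 ∨ q = p.1.2

inductive Alive {n : ℕ} (p : ℕ → Pr n) (hi : ℕ) (t : Fin n) : ℕ → Fin n → Prop
  | base (k : ℕ) : Alive p hi t k t
  | skip (k : ℕ) (q : Fin n) : Alive p hi t (k + 1) q → Alive p hi t k q
  | step (k : ℕ) (q q' : Fin n) : k < hi → On (p k) q → On (p k) q' → Alive p hi t (k + 1) q' →
      Alive p hi t k q

/-- if nothing touches `t` from `k` on, only `t` is alive. -/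
theorem alive_only {n : ℕ} {p : ℕ → Pr n} {hi : ℕ} {t : Fin n} {k : ℕ} {q : Fin n}
    (h : Alive p hi t k q) (hno : ∀ j, k ≤ j → j < hi → ¬ On (p j) t) : q = t := by
  induction h with
  | base k => rfl
  | skip k q h ih => exact ih (fun j h1 h2 => hno j (by omega) h2)
  | step k q q' hk h1 h2 h3 ih =>
    have := ih (fun j h1 h2 => hno j (by omega) h2)
    subst this
    exact absurd h2 (hno k le_rfl hk)

theorem slice {n : ℕ} (p : ℕ → Pr n) (hi : ℕ) (t : Fin n) (Q : Fin n → Fin 4) (m : ℕ) :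
    ∀ (k : ℕ), k + m = hi → ∀ (x : ℕ → SU4) (_ : ∀ i, GoodS (x i)) (σ : Fin n → Fin 4) (_ : Tr p x Q k σ)
      (_ : σ ≠ 0) (_ : ∀ q, σ q ≠ 0 → Alive p hi t k q) (_ : ∃ j, k ≤ j ∧ j < hi ∧ On (p j) t),
    ∃ y : ℕ → SU4, (∀ i, GoodS (y i)) ∧ (∀ i < k, y i = x i) ∧ ∃ j, k ≤ j ∧ j < hi ∧ ∃ τ, τ ≠ 0 ∧
      (∀ q, τ q ≠ 0 → On (p j) q) ∧ Tr p y Q (j + 1) τ := by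
  induction m with
  | zero =>
    rintro k hk x hx σ hT h0 hA ⟨j, h1, h2, -⟩
    omega
  | succ m ih =>
    rintro k hk x hx σ hT h0 hA htouch
    -- the next state after choosing a gate
    have next : ∀ (u : SU4), GoodS u → ∀ s' e, IsSgn e →
        u.1 * pauli2 (res (p k).1 σ) = e • (pauli2 s' * u.1) →
        (∀ i, GoodS (Function.update x k u i)) ∧ (∀ i < k, Function.update x k u i = x i) ∧
        Tr p (Function.update x k u) Q (k + 1) (repl (p k).1 σ s') := by
      intro u hu s' e he h
      refine ⟨?_, ?_, ?_⟩
      · intro i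
        by_cases hik : i = k
        · subst hik; simpa using hu
        · simpa [Function.update_of_ne hik] using hx i
      · intro i hik; exact Function.update_of_ne (by omega) _ _
      · have hT' : Tr p (Function.update x k u) Q k σ :=
          hT.congr (fun i hik => (Function.update_of_ne (by omega) _ _).symm)
        exact hT'.succ s' e he (by simpa using h)
    by_cases hlater : ∃ j, k + 1 ≤ j ∧ j < hi ∧ On (p j) t
    · -- continue
      suffices H : ∃ (u : SU4) (_ : GoodS u) (s' : Fin 2 → Fin 4) (e : ℂ) (_ : IsSgn e),
          u.1 * pauli2 (res (p k).1 σ) = e • (pauli2 s' * u.1) ∧ repl (p k).1 σ s' ≠ 0 ∧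
          ∀ q, repl (p k).1 σ s' q ≠ 0 → Alive p hi t (k + 1) q by
        obtain ⟨u, hu, s', e, he, hr, hne, hal⟩ := H
        obtain ⟨n1, n2, n3⟩ := next u hu s' e he hr
        obtain ⟨y, y1, y2, j, j1, j2, τ, hτ⟩ := ih (k + 1) (by omega) _ n1 _ n3 hne hal hlater
        exact ⟨y, y1, fun i hik => (y2 i (by omega)).trans (n2 i hik), j, by omega, j2, τ, hτ⟩
      have hp := (p k).2
      -- alive off the gate
      have hoff : ∀ q, σ q ≠ 0 → ¬ On (p k) q → Alive p hi t (k + 1) q := by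
        intro q hq hn
        cases hA q hq with
        | base => exact Alive.base _
        | skip _ _ h => exact h
        | step _ _ q' h1 h2 h3 h4 => exact absurd h2 hn
      by_cases hs : σ (p k).1.1 ≠ 0 ∨ σ (p k).1.2 ≠ 0
      · -- some qubit of the gate stays alive
        have : ∃ q', On (p k) q' ∧ Alive p hi t (k + 1) q' := by
          have aux : ∀ q, On (p k) q → σ q ≠ 0 → ∃ q', On (p k) q' ∧ Alive p hi t (k + 1) q' := by
            intro q hon hq
            cases hA q hq with
            | base => exact ⟨t, hon, Alive.base _⟩
            | skip _ _ h => exact ⟨q, hon, h⟩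
            | step _ _ q' h1 h2 h3 h4 => exact ⟨q', h3, h4⟩
          rcases hs with h | h
          · exact aux _ (Or.inl rfl) h
          · exact aux _ (Or.inr rfl) h
        obtain ⟨q', hon, hal⟩ := this
        rcases hon with rfl | rfl
        · obtain ⟨u, hu, e, c, d, he, h1, -, h3⟩ := move 0 _ _ hs
          obtain ⟨hc, rfl⟩ := h1 rfl
          refine ⟨u, hu, ![c, 0], e, he, h3, repl_ne hp (fun h => hc (congrFun h 0)), ?_⟩
          intro q hq
          by_cases q1 : q = (p k).1.1
          · rw [q1]; exact hal
          by_cases q2 : q = (p k).1.2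
          · exfalso; apply hq; rw [q2, repl_snd]; rfl
          · rw [repl_other _ _ _ _ q1 q2] at hq
            exact hoff q hq (by rintro (h | h) <;> contradiction)
        · obtain ⟨u, hu, e, c, d, he, -, h1, h3⟩ := move 1 _ _ hs
          obtain ⟨rfl, hd⟩ := h1 rfl
          refine ⟨u, hu, ![0, d], e, he, h3, repl_ne hp (fun h => hd (congrFun h 1)), ?_⟩
          intro q hq
          by_cases q2 : q = (p k).1.2
          · rw [q2]; exact hal
          by_cases q1 : q = (p k).1.1
          · exfalso; apply hq; rw [q1, repl_fst _ hp]; rfl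
          · rw [repl_other _ _ _ _ q1 q2] at hq
            exact hoff q hq (by rintro (h | h) <;> contradiction)
      · push Not at hs
        have hrep : repl (p k).1 σ (res (p k).1 σ) = σ := by
          ext1 i
          by_cases q2 : i = (p k).1.2
          · rw [q2, repl_snd]; rfl
          by_cases q1 : i = (p k).1.1
          · rw [q1, repl_fst _ hp]; rfl
          · rw [repl_other _ _ _ _ q1 q2]
        refine ⟨1, good_one, res (p k).1 σ, 1, Or.inl rfl, by simp, by rw [hrep]; exact h0, ?_⟩
        rw [hrep]
        intro q hq
        refine hoff q hq ?_
        rintro (rfl | rfl)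
        · exact hq hs.1
        · exact hq hs.2
    · -- the gate `k` is the last one touching `t`
      push Not at hlater
      obtain ⟨j, h1, h2, h3⟩ := htouch
      have hjk : j = k := by
        by_contra hne
        exact hlater j (by omega) h2 h3
      subst hjk
      have hon : ∀ q, σ q ≠ 0 → On (p j) q := by
        intro q hq
        cases hA q hq with
        | base => exact h3
        | skip _ _ h => rw [alive_only h hlater]; exact h3
        | step _ _ q' _ h _ _ => exact h
      obtain ⟨n1, n2, n3⟩ := next 1 good_one (res (p j).1 σ) 1 (Or.inl rfl) (by simp)
      have hp := (p j).2
      have hrep : repl (p j).1 σ (res (p j).1 σ) = σ := by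
        ext1 i
        by_cases q2 : i = (p j).1.2
        · rw [q2, repl_snd]; rfl
        by_cases q1 : i = (p j).1.1
        · rw [q1, repl_fst _ hp]; rfl
        · rw [repl_other _ _ _ _ q1 q2]
      rw [hrep] at n3
      exact ⟨_, n1, n2, j, le_rfl, h2, σ, h0, hon, n3⟩

end
end CP

namespace CP
noncomputable section

theorem Alive.mono {n : ℕ} {p : ℕ → Pr n} {hi : ℕ} {t : Fin n} {q : Fin n} (d : ℕ) :
    ∀ {k : ℕ}, Alive p hi t (k + d) q → Alive p hi t k q := by
  induction d with
  | zero => intro k h; exact h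
  | succ d ih => intro k h; exact ih (Alive.skip _ _ h)

theorem alive_of_path {n R : ℕ} (p : ℕ → Pr n) (A : Architecture n R) (hpA : ∀ i : Fin R, p i = A i)
    (hi : ℕ) (t : Fin n) (m : ℕ) : ∀ (k : ℕ) (q : Fin n) (idx : Fin m → Fin R) (qs : Fin (m + 1) → Fin n),
    StrictMono idx → (∀ l, k ≤ (idx l : ℕ) ∧ (idx l : ℕ) < hi) → qs 0 = q → qs (Fin.last m) = t →
    (∀ l : Fin m,
      (qs l.castSucc = (A (idx l)).1.1 ∨ qs l.castSucc = (A (idx l)).1.2) ∧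
      (qs l.succ = (A (idx l)).1.1 ∨ qs l.succ = (A (idx l)).1.2)) → Alive p hi t k q := by
  induction m with
  | zero =>
    intro k q idx qs _ _ h0 h1 _
    have : q = t := by rw [← h0, ← h1]; rfl
    subst this; exact Alive.base _
  | succ m ih =>
    intro k q idx qs hm hb h0 h1 hs
    have ha := ih ((idx 0 : ℕ) + 1) (qs 1) (fun l => idx l.succ) (fun l => qs l.succ)
      (fun a b hab => hm (by simpa using hab)) ?_ rfl ?_ ?_
    · obtain ⟨d, hd⟩ := Nat.exists_eq_add_of_le (hb 0).1
      apply Alive.mono d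
      rw [← hd]
      refine Alive.step _ q (qs 1) (hb 0).2 ?_ ?_ ha
      · rw [On, hpA, ← h0]; exact (hs 0).1
      · rw [On, hpA]; exact (hs 0).2
    · intro l
      have : idx 0 < idx l.succ := hm (Fin.succ_pos l)
      exact ⟨this, (hb _).2⟩
    · rw [← h1]; rfl
    · intro l
      exact hs l.succ

theorem circuit {n T L : ℕ} (hn : 2 ≤ n) (A : Architecture n (T * L))
    (hslices : ∀ s < T, IsCausalSlice A (s * L) ((s + 1) * L)) (p : ℕ → Pr n)
    (hpA : ∀ i : Fin (T * L), p i = A i) (Q : ℕ → Fin n → Fin 4) (hQ : ∀ s < T, Q s ≠ 0) (S : ℕ) (hS : S ≤ T) :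
    ∃ x : ℕ → SU4, (∀ i, GoodS (x i)) ∧ ∀ s < S, ∃ j < S * L, ∃ τ, τ ≠ 0 ∧
      (∀ q, τ q ≠ 0 → On (p j) q) ∧ Tr p x (Q s) (j + 1) τ := by
  induction S with
  | zero => exact ⟨fun _ => 1, fun _ => good_one, by simp⟩
  | succ S ih =>
    obtain ⟨x, hx, hh⟩ := ih (by omega)
    obtain ⟨t, ht⟩ := hslices S (by omega)
    obtain ⟨σ, hσ, hT⟩ := Tr.exists_all (p := p) hx (hQ S (by omega)) (S * L)
    have htouch : ∃ j, S * L ≤ j ∧ j < (S + 1) * L ∧ On (p j) t := by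
      have : Nontrivial (Fin n) := Fin.nontrivial_iff_two_le.mpr hn
      obtain ⟨q, hq⟩ := exists_ne t
      obtain ⟨m, idx, qs, h1, h2, h3, h4, h5⟩ := ht q
      cases m with
      | zero => exact absurd (h3.symm.trans h4) hq
      | succ m =>
        refine ⟨idx (Fin.last m), (h2 _).1, (h2 _).2, ?_⟩
        rw [On, hpA, ← h4]
        exact (h5 (Fin.last m)).2
    obtain ⟨y, hy, hyx, j, j1, j2, τ, hτ⟩ := slice p ((S + 1) * L) t (Q S) L (S * L) (by ring) x hx σ hT hσ
      (fun q _ => by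
        obtain ⟨m, idx, qs, h1, h2, h3, h4, h5⟩ := ht q
        exact alive_of_path p A hpA _ t m _ q idx qs h1 h2 h3 h4 h5) htouch
    refine ⟨y, hy, ?_⟩
    intro s hs
    by_cases hsS : s = S
    · subst hsS; exact ⟨j, j2, τ, hτ⟩
    · obtain ⟨j', hj', τ', h1, h2, h3⟩ := hh s (by omega)
      refine ⟨j', by rw [Nat.succ_mul]; omega, τ', h1, h2, h3.congr fun i hi => (hyx i (by omega)).symm⟩

/-! ### target Pauli strings -/

abbrev Idx (n : ℕ) := {z : QubitBasis n // z ≠ 0} × Bool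

theorem Idx.pos {n : ℕ} (z : {z : QubitBasis n // z ≠ 0}) : ∃ i, z.1 i = 1 := by
  obtain ⟨i, hi⟩ := Function.ne_iff.mp z.2
  refine ⟨i, ?_⟩
  have : z.1 i ≠ 0 := hi
  omega

def tgt {n : ℕ} (v : Idx n) : Fin n → Fin 4 := fun i =>
  if v.1.1 i = 1 then (if v.2 = true ∧ i = (Idx.pos v.1).choose then 2 else 1) else 0

theorem tgt_ne {n : ℕ} (v : Idx n) : tgt v ≠ 0 := by
  intro h
  obtain ⟨i, hi⟩ := Idx.pos v.1
  have := congrFun h i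
  rw [tgt, if_pos hi] at this
  split_ifs at this <;> simp at this

def ph {n : ℕ} (v : Idx n) : ℂ := if v.2 = true then Complex.I else 1

theorem pauli_col0 (a : Fin 2) : pauli 0 a 0 = if a = 0 then 1 else 0 := by
  rw [← Matrix.one_apply]; rfl

theorem pauli_col1 (a : Fin 2) : pauli 1 a 0 = if a = 1 then 1 else 0 := by
  fin_cases a <;> simp [pauli]

theorem pauli_col2 (a : Fin 2) : pauli 2 a 0 = if a = 1 then Complex.I else 0 := by
  fin_cases a <;> simp [pauli]

theorem ps_ket {n : ℕ} (v : Idx n) (a : QubitBasis n) :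
    (pauliString (tgt v) *ᵥ ket0 n) a = if a = v.1.1 then ph v else 0 := by
  have h1 : (pauliString (tgt v) *ᵥ ket0 n) a = pauliString (tgt v) a 0 := by
    rw [Matrix.mulVec, dotProduct, Finset.sum_eq_single (0 : QubitBasis n)]
    · have hk : ket0 n 0 = 1 := if_pos rfl
      rw [hk, mul_one]
    · intro b _ hb
      have hk : ket0 n b = 0 := if_neg hb
      rw [hk, mul_zero]
    · simp
  have hterm : ∀ i, pauli (tgt v i) (a i) 0 = if a i = v.1.1 i then
      (if v.2 = true ∧ i = (Idx.pos v.1).choose then Complex.I else 1) else 0 := by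
    intro i
    have hz : v.1.1 i = 0 ∨ v.1.1 i = 1 := by omega
    have hpos := (Idx.pos v.1).choose_spec
    rw [tgt]
    rcases hz with hz | hz
    · have hne : ¬ (v.2 = true ∧ i = (Idx.pos v.1).choose) := by
        rintro ⟨-, h⟩; rw [← h, hz] at hpos; simp at hpos
      rw [hz, if_neg (by decide), pauli_col0, if_neg hne]
    · rw [hz, if_pos rfl]
      by_cases hc : v.2 = true ∧ i = (Idx.pos v.1).choose
      · rw [if_pos hc, if_pos hc, pauli_col2]
      · rw [if_neg hc, if_neg hc, pauli_col1]
  rw [h1, pauliString]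
  simp only [Pi.zero_apply, hterm]
  split_ifs with ha
  · subst ha
    simp only [if_true]
    rw [ph]
    split_ifs with hb
    · simp [hb]
    · simp [hb]
  · obtain ⟨i, hi⟩ := Function.ne_iff.mp ha
    exact Finset.prod_eq_zero (Finset.mem_univ i) (if_neg hi)

def vec {n : ℕ} (v : Idx n) : QubitBasis n → ℂ := Complex.I • (pauliString (tgt v) *ᵥ ket0 n)

theorem vec_apply {n : ℕ} (v : Idx n) (a : QubitBasis n) :
    vec v a = if a = v.1.1 then Complex.I * ph v else 0 := by
  rw [vec, Pi.smul_apply, ps_ket]; split_ifs <;> simp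

theorem vec_indep (n : ℕ) : LinearIndependent ℝ (vec : Idx n → QubitBasis n → ℂ) := by
  rw [Fintype.linearIndependent_iff]
  intro g hg
  have key : ∀ z, (g (z, false) : ℂ) * Complex.I - g (z, true) = 0 := by
    intro z
    have := congrFun hg z.1
    rw [Finset.sum_apply, Fintype.sum_prod_type, Finset.sum_eq_single z] at this
    · simp only [Fintype.sum_bool, Pi.smul_apply, vec_apply, if_true, ph, Complex.real_smul] at this
      simp at this
      linear_combination this
    · intro z' _ hz
      have : z.1 ≠ z'.1 := fun h => hz (Subtype.ext h.symm)
      simp [vec_apply, this]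
    · simp
  rintro ⟨z, b⟩
  have h := key z
  rw [Complex.ext_iff] at h
  simp at h
  cases b
  · exact h.2
  · exact h.1

theorem card_idx (n : ℕ) : Fintype.card (Idx n) = 2 ^ (n + 1) - 2 := by
  rw [Fintype.card_prod, Fintype.card_subtype_compl, Fintype.card_bool]
  simp [pow_succ]
  omega

/-! ### relation with the differential -/

theorem take_prod {n R : ℕ} (A : Architecture n R) (p : ℕ → Pr n) (hpA : ∀ i : Fin R, p i = A i)
    (x : ℕ → SU4) (k : ℕ) (hk : k ≤ R) :
    ((gateList A (fun i => x i)).take k).reverse.prod = W p x k := by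
  induction k with
  | zero => simp [W]
  | succ k ih =>
    have hl : k < (gateList A (fun i => x i)).length := by simpa [gateList] using hk
    rw [List.take_succ_eq_append_getElem hl, List.reverse_append, List.prod_append, ih (by omega), W]
    congr 1
    simp [gateList]
    rw [← hpA]

theorem mem_image {n R : ℕ} (A : Architecture n R) (p : ℕ → Pr n) (hpA : ∀ i : Fin R, p i = A i)
    (x : ℕ → SU4) (j : Fin R) (Q τ : Fin n → Fin 4) (hτ : τ ≠ 0) (hon : ∀ q, τ q ≠ 0 → On (p j) q)
    (hT : Tr p x Q (j + 1) τ) :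
    W p x R *ᵥ (Complex.I • (pauliString Q *ᵥ ket0 n)) ∈
    Submodule.map ((mulVecKet0 n) ∘ₗ contractDiff A (fun i : Fin R => x i))
      (Submodule.pi Set.univ fun _ => suAlgebra (Fin 4)) := by
  obtain ⟨e, he, hT⟩ := hT
  set s := res (p j).1 τ with hs
  have hs0 : s ≠ 0 := by
    obtain ⟨q, hq⟩ := Function.ne_iff.mp hτ
    apply res_ne
    rcases hon q hq with h | h
    · left; rw [← h]; exact hq
    · right; rw [← h]; exact hq
  set H : Matrix (Fin 4) (Fin 4) ℂ := (e * Complex.I) • pauli2 s with hH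
  have hstar : star e = e := by rcases he with rfl | rfl <;> simp
  have hee : e * e = 1 := by rcases he with rfl | rfl <;> simp
  have hsu : H ∈ suAlgebra (Fin 4) := by
    apply Submodule.subset_span
    refine ⟨?_, ?_⟩
    · rw [hH, Matrix.conjTranspose_smul, pauli2_herm, star_mul', hstar, ← neg_smul]
      congr 1; simp
    · rw [hH, Matrix.trace_smul, pauli2_trace s hs0, smul_zero]
  refine ⟨Pi.single j H, ?_, ?_⟩
  · intro i _
    by_cases hij : i = j
    · subst hij; simpa using hsu
    · simp [hij]
  · have hD : contractDiff A (fun i : Fin R => x i) (Pi.single j H) =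
        ((gateList A (fun i : Fin R => x i)).drop (j + 1)).reverse.prod *
          (embedGate (A j).1 H * W p x (j + 1)) := by
      rw [contractDiff, LinearMap.sum_apply, Finset.sum_eq_single j]
      · simp only [LinearMap.comp_apply, LinearMap.proj_apply, Pi.single_eq_same, LinearMap.mulLeft_apply,
          LinearMap.mulRight_apply]
        rw [take_prod A p hpA x j (by omega), W, hpA]; rfl
      · intro i _ hij
        simp [hij]
      · simp
    have hE : embedGate (A j).1 H = (e * Complex.I) • pauliString τ := by
      rw [ps_eq_embed (p j).1 (p j).2 τ hon, ← hs, hH, ← hpA]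
      ext a b
      simp only [embed_apply, Matrix.smul_apply]
      split_ifs <;> simp
    have hdrop : ((gateList A (fun i : Fin R => x i)).drop (j + 1)).reverse.prod * W p x (j + 1) = W p x R := by
      rw [← take_prod A p hpA x (j + 1) (by omega), ← take_prod A p hpA x R le_rfl, ← List.prod_append,
        ← List.reverse_append, List.take_append_drop, List.take_of_length_le (by simp [gateList])]
    have hτW : pauliString τ * W p x (j + 1) = e • (W p x (j + 1) * pauliString Q) := by
      rw [hT, smul_smul, hee, one_smul]
    change contractDiff A (fun i : Fin R => x i) (Pi.single j H) *ᵥ ket0 n = _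
    rw [hD, hE, Matrix.smul_mul, hτW, smul_smul, Matrix.mul_smul, ← mul_assoc, hdrop, Matrix.smul_mulVec,
      Matrix.mulVec_smul, Matrix.mulVec_mulVec]
    congr 1
    linear_combination Complex.I * hee

theorem main (n T L : ℕ) (hn : 2 ≤ n) (hT : T ≤ 2 ^ (n + 1) - 2)
    (A : Architecture n (T * L))
    (hslices : ∀ s < T, IsCausalSlice A (s * L) ((s + 1) * L)) :
    ∃ x : Fin (T * L) → SU4,
      (∀ i, IsCliffordGate (x i : Matrix (Fin 4) (Fin 4) ℂ)) ∧
      T ≤ stateRankAt A x := by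
  let dflt : Pr n := ⟨(⟨0, by omega⟩, ⟨1, by omega⟩), by simp⟩
  let p : ℕ → Pr n := fun k => if h : k < T * L then A ⟨k, h⟩ else dflt
  have hpA : ∀ i : Fin (T * L), p i = A i := by
    intro i; simp [p]
  obtain ⟨f⟩ : Nonempty (Fin T ↪ Idx n) :=
    Function.Embedding.nonempty_of_card_le (by rw [card_idx, Fintype.card_fin]; exact hT)
  let Q : ℕ → Fin n → Fin 4 := fun s => if h : s < T then tgt (f ⟨s, h⟩) else 0
  have hQ : ∀ s : Fin T, Q s = tgt (f s) := by intro s; simp [Q]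
  obtain ⟨x, hx, hh⟩ := circuit hn A hslices p hpA Q (fun s hs => by
    rw [hQ ⟨s, hs⟩]; exact tgt_ne _) T le_rfl
  refine ⟨fun i => x i, fun i => (hx i).clifford ?_, ?_⟩
  · exact (Matrix.mem_specialUnitaryGroup_iff.mp (x i).2).1.2
  · obtain ⟨V, hV⟩ := W_inv p x (T * L)
    let F : (QubitBasis n → ℂ) →ₗ[ℝ] (QubitBasis n → ℂ) :=
      (Matrix.mulVecLin (W p x (T * L))).restrictScalars ℝ
    have hF : Function.Injective F := by
      intro a b hab
      have : V *ᵥ (W p x (T * L) *ᵥ a) = V *ᵥ (W p x (T * L) *ᵥ b) := congrArg _ hab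
      simpa [Matrix.mulVec_mulVec, hV] using this
    have hli : LinearIndependent ℝ (fun s : Fin T => F (vec (f s))) :=
      ((vec_indep n).comp f f.injective).map' F (LinearMap.ker_eq_bot.mpr hF)
    have hmem : ∀ s : Fin T, F (vec (f s)) ∈
        Submodule.map ((mulVecKet0 n) ∘ₗ contractDiff A (fun i : Fin (T * L) => x i))
          (Submodule.pi Set.univ fun _ => suAlgebra (Fin 4)) := by
      intro s
      obtain ⟨j, hj, τ, h1, h2, h3⟩ := hh s s.2
      have := mem_image A p hpA x ⟨j, hj⟩ (Q s) τ h1 h2 h3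
      rw [hQ] at this
      exact this
    rw [stateRankAt]
    have hli2 : LinearIndependent ℝ (fun s : Fin T => (⟨F (vec (f s)), hmem s⟩ :
        ↥(Submodule.map ((mulVecKet0 n) ∘ₗ contractDiff A (fun i : Fin (T * L) => x i))
          (Submodule.pi Set.univ fun _ => suAlgebra (Fin 4))))) :=
      LinearIndependent.of_comp (Submodule.subtype _) hli
    simpa using hli2.fintype_card_le_finrank

end
end CP

/-! ## Statement 7: a Clifford point of high rank for the state map -/

/-- **A high-rank Clifford point for the state map `G^A : x ↦ F^A(x)|0^n⟩`** (the map into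
the unit sphere of `ℂ^{2^n}`).  Let `A` be an `n`-qubit architecture with `R = T·L` gates
that is the concatenation of `T` consecutive causal slices of `L` gates each, with
`T ≤ 2^{n+1} − 2`.  Then there is a point `x ∈ SU(4)^{×R}`, all of whose entries are
Clifford gates, at which the differential of `G^A` has rank at least `T`. -/
theorem exists_clifford_point_of_high_state_rank
    (n T L : ℕ) (hn : 2 ≤ n) (hT : T ≤ 2 ^ (n + 1) - 2)
    (A : Architecture n (T * L))
    (hslices : ∀ s < T, IsCausalSlice A (s * L) ((s + 1) * L)) :
    ∃ x : Fin (T * L) → SU4,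
      (∀ i, IsCliffordGate (x i : Matrix (Fin 4) (Fin 4) ℂ)) ∧
      T ≤ stateRankAt A x := by
  exact CP.main n T L hn hT A hslices
end

section
/- Let n ≥ 2 and let A be an n-qubit architecture with L gates that forms a single causal slice with sink qubit t (i.e., every qubit is connected to t by a path of gates of A, in the sense of the causal-slice definition). Then for every nontrivial n-qubit Pauli string P there exists an assignment of Clifford gates u_1, …, u_L ∈ SU(4) such that the contracted unitary C = F^A(u_1, …, u_L) satisfies C P C† = Z_t, the Pauli string acting as Z on qubit t and as the identity on all other qubits. -/
open scoped Matrix ENNReal Classical Kronecker ComplexOrder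
open MeasureTheory

/-! ### Helper material -/

namespace CausalAux

/-- Kronecker product of two one-qubit matrices as a `4 × 4` matrix. -/
noncomputable def k2 (M N : Matrix (Fin 2) (Fin 2) ℂ) : Matrix (Fin 4) (Fin 4) ℂ :=
  fun a b =>
    M ⟨a.val / 2, by have := a.isLt; omega⟩ ⟨b.val / 2, by have := b.isLt; omega⟩ *
    N ⟨a.val % 2, by have := a.isLt; omega⟩ ⟨b.val % 2, by have := b.isLt; omega⟩

theorem pauli2_eq (s : Fin 2 → Fin 4) : pauli2 s = k2 (pauli (s 0)) (pauli (s 1)) := rfl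

theorem k2_mul (M N M' N' : Matrix (Fin 2) (Fin 2) ℂ) :
    k2 M N * k2 M' N' = k2 (M * M') (N * N') := by
  ext i j
  simp only [k2, Matrix.mul_apply, Fin.sum_univ_four, Fin.sum_univ_two]
  have h0 : (⟨((0 : Fin 4) : ℕ) / 2, by decide⟩ : Fin 2) = 0 := rfl
  have h1 : (⟨((1 : Fin 4) : ℕ) / 2, by decide⟩ : Fin 2) = 0 := rfl
  have h2 : (⟨((2 : Fin 4) : ℕ) / 2, by decide⟩ : Fin 2) = 1 := rfl
  have h3 : (⟨((3 : Fin 4) : ℕ) / 2, by decide⟩ : Fin 2) = 1 := rfl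
  have g0 : (⟨((0 : Fin 4) : ℕ) % 2, by decide⟩ : Fin 2) = 0 := rfl
  have g1 : (⟨((1 : Fin 4) : ℕ) % 2, by decide⟩ : Fin 2) = 1 := rfl
  have g2 : (⟨((2 : Fin 4) : ℕ) % 2, by decide⟩ : Fin 2) = 0 := rfl
  have g3 : (⟨((3 : Fin 4) : ℕ) % 2, by decide⟩ : Fin 2) = 1 := rfl
  rw [h0, h1, h2, h3, g0, g1, g2, g3]
  ring

theorem k2_one : k2 1 1 = 1 := by
  ext i j
  fin_cases i <;> fin_cases j <;> simp [k2, Matrix.one_apply]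

theorem k2_conj (M N : Matrix (Fin 2) (Fin 2) ℂ) : (k2 M N)ᴴ = k2 Mᴴ Nᴴ := by
  ext i j
  simp [k2, Matrix.conjTranspose_apply]

theorem k2_smul (c d : ℂ) (M N : Matrix (Fin 2) (Fin 2) ℂ) :
    k2 (c • M) (d • N) = (c * d) • k2 M N := by
  ext i j
  simp [k2]
  ring

/-- product of Pauli labels -/
def pm (a b : Fin 4) : Fin 4 :=
  if a = 0 then b else if b = 0 then a else if a = b then 0 else
    ⟨(6 - a.val - b.val) % 4, by omega⟩

/-- commutation sign -/
def sg (a b : Fin 4) : ℤ := if a = 0 ∨ b = 0 ∨ a = b then 1 else -1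

theorem pauli_mul (a b : Fin 4) : ∃ c : ℂ, pauli a * pauli b = c • pauli (pm a b) := by
  have key : ∀ (c : ℂ), pauli a * pauli b = c • pauli (pm a b) →
    ∃ c : ℂ, pauli a * pauli b = c • pauli (pm a b) := fun c h => ⟨c, h⟩
  fin_cases a <;> fin_cases b <;>
  first
  | (refine key 1 ?_; ext i j; fin_cases i <;> fin_cases j <;>
      simp [pauli, pm, Matrix.mul_apply, Fin.sum_univ_two] <;> done)
  | (refine key Complex.I ?_; ext i j; fin_cases i <;> fin_cases j <;>
      simp [pauli, pm, Matrix.mul_apply, Fin.sum_univ_two] <;> done)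
  | (refine key (-Complex.I) ?_; ext i j; fin_cases i <;> fin_cases j <;>
      simp [pauli, pm, Matrix.mul_apply, Fin.sum_univ_two] <;> done)

theorem pauli_comm (a b : Fin 4) :
    pauli a * pauli b = ((sg a b : ℤ) : ℂ) • (pauli b * pauli a) := by
  fin_cases a <;> fin_cases b <;> ext i j <;> fin_cases i <;> fin_cases j <;>
      simp [pauli, sg, Matrix.mul_apply, Fin.sum_univ_two]

theorem pauli_sq (a : Fin 4) : pauli a * pauli a = 1 := by
  fin_cases a <;> ext i j <;> fin_cases i <;> fin_cases j <;>
      simp [pauli, Matrix.mul_apply, Fin.sum_univ_two]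

theorem pauli_herm (a : Fin 4) : (pauli a)ᴴ = pauli a := by
  fin_cases a <;> ext i j <;> fin_cases i <;> fin_cases j <;>
      simp [pauli, Matrix.conjTranspose_apply]

theorem pauli2_sq (s : Fin 2 → Fin 4) : pauli2 s * pauli2 s = 1 := by
  rw [pauli2_eq, k2_mul, pauli_sq, pauli_sq, k2_one]

theorem pauli2_herm (s : Fin 2 → Fin 4) : (pauli2 s)ᴴ = pauli2 s := by
  rw [pauli2_eq, k2_conj, pauli_herm, pauli_herm]

theorem pauli2_mul (s r : Fin 2 → Fin 4) :
    ∃ (c : ℂ) (w : Fin 2 → Fin 4), pauli2 s * pauli2 r = c • pauli2 w := by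
  obtain ⟨c, hc⟩ := pauli_mul (s 0) (r 0)
  obtain ⟨d, hd⟩ := pauli_mul (s 1) (r 1)
  refine ⟨c * d, ![pm (s 0) (r 0), pm (s 1) (r 1)], ?_⟩
  rw [pauli2_eq, pauli2_eq, k2_mul, hc, hd, k2_smul, pauli2_eq]
  rfl

theorem pauli2_comm (s r : Fin 2 → Fin 4) :
    pauli2 s * pauli2 r =
      ((sg (s 0) (r 0) * sg (s 1) (r 1) : ℤ) : ℂ) • (pauli2 r * pauli2 s) := by
  rw [pauli2_eq, pauli2_eq, k2_mul, pauli_comm (s 0), pauli_comm (s 1), k2_smul, k2_mul]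
  push_cast
  rfl

theorem sg_cases (a b : Fin 4) : sg a b = 1 ∨ sg a b = -1 := by
  unfold sg; split <;> simp

theorem pauli2_comm_or (s r : Fin 2 → Fin 4) :
    pauli2 s * pauli2 r = pauli2 r * pauli2 s ∨
    pauli2 s * pauli2 r = -(pauli2 r * pauli2 s) := by
  rw [pauli2_comm]
  rcases sg_cases (s 0) (r 0) with h | h <;> rcases sg_cases (s 1) (r 1) with h' | h' <;>
    simp [h, h']

/-- Clifford-conjugate -/
def Conn (s r : Fin 2 → Fin 4) : Prop :=
  ∃ u : Matrix (Fin 4) (Fin 4) ℂ, u * uᴴ = 1 ∧ IsCliffordGate u ∧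
    u * pauli2 s * uᴴ = pauli2 r

theorem Conn.refl (s : Fin 2 → Fin 4) : Conn s s :=
  ⟨1, by simp, fun r => ⟨1, r, by simp⟩, by simp⟩

theorem Conn.trans {s r w : Fin 2 → Fin 4} (h : Conn s r) (h' : Conn r w) : Conn s w := by
  obtain ⟨u, hu, hc, he⟩ := h
  obtain ⟨v, hv, hc', he'⟩ := h'
  have e : ∀ M, (v * u) * M * (v * u)ᴴ = v * (u * M * uᴴ) * vᴴ := by
    intro M; rw [Matrix.conjTranspose_mul]; simp only [Matrix.mul_assoc]
  refine ⟨v * u, ?_, ?_, ?_⟩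
  · have := e 1
    simpa [hu, hv] using this
  · intro z
    obtain ⟨c, z', hz⟩ := hc z
    obtain ⟨d, z'', hz'⟩ := hc' z'
    refine ⟨c * d, z'', ?_⟩
    rw [e, hz, Matrix.mul_smul, Matrix.smul_mul, hz', smul_smul]
  · rw [e, he, he']

theorem Conn.of_anti {s r : Fin 2 → Fin 4}
    (h : pauli2 s * pauli2 r = -(pauli2 r * pauli2 s)) : Conn s r := by
  obtain ⟨c, hcs, hcc⟩ : ∃ c : ℂ, star c = c ∧ c * c = 1 / 2 := by
    refine ⟨((√2)⁻¹ : ℝ), by simp, ?_⟩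
    rw [← Complex.ofReal_mul, ← mul_inv, Real.mul_self_sqrt (by norm_num)]
    norm_num
  set P := pauli2 s with hP
  set Q := pauli2 r with hQ
  have hPP : P * P = 1 := pauli2_sq s
  have hQQ : Q * Q = 1 := pauli2_sq r
  have hPH : Pᴴ = P := pauli2_herm s
  have hQH : Qᴴ = Q := pauli2_herm r
  have hconj : (c • (1 + Q * P))ᴴ = c • (1 + P * Q) := by
    rw [Matrix.conjTranspose_smul, hcs, Matrix.conjTranspose_add, Matrix.conjTranspose_mul,
      hPH, hQH, Matrix.conjTranspose_one]
  have e : ∀ M, (c • (1 + Q * P)) * M * (c • (1 + Q * P))ᴴ =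
      (1 / 2 : ℂ) • ((1 + Q * P) * M * (1 + P * Q)) := by
    intro M
    rw [hconj, Matrix.smul_mul, Matrix.smul_mul, Matrix.mul_smul, smul_smul, hcc]
  have q1 : Q * P * (P * Q) = 1 := by
    rw [Matrix.mul_assoc, ← Matrix.mul_assoc P, hPP, Matrix.one_mul, hQQ]
  have hun : (1 + Q * P) * (1 + P * Q) = (2 : ℂ) • (1 : Matrix (Fin 4) (Fin 4) ℂ) := by
    have : (1 + Q * P) * (1 + P * Q) = 1 + P * Q + Q * P + Q * P * (P * Q) := by noncomm_ring
    rw [this, q1, h, two_smul]; abel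
  refine ⟨c • (1 + Q * P), ?_, ?_, ?_⟩
  · have := e 1
    rw [Matrix.mul_one, Matrix.mul_one, hun, smul_smul] at this
    rw [this]; norm_num
  · intro z
    have h1 : Q * P * pauli2 z = pauli2 z * (Q * P) ∨
        Q * P * pauli2 z = -(pauli2 z * (Q * P)) := by
      rcases pauli2_comm_or s z with h1 | h1 <;> rcases pauli2_comm_or r z with h2 | h2 <;>
        rw [← hP] at h1 <;> rw [← hQ] at h2
      · left; rw [Matrix.mul_assoc, h1, ← Matrix.mul_assoc, h2, Matrix.mul_assoc]
      · right; rw [Matrix.mul_assoc, h1, ← Matrix.mul_assoc, h2, Matrix.neg_mul, Matrix.mul_assoc]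
      · right; rw [Matrix.mul_assoc, h1, Matrix.mul_neg, ← Matrix.mul_assoc, h2, Matrix.mul_assoc]
      · left; rw [Matrix.mul_assoc, h1, Matrix.mul_neg, ← Matrix.mul_assoc, h2, Matrix.neg_mul,
          neg_neg, Matrix.mul_assoc]
    rcases h1 with h1 | h1
    · refine ⟨1, z, ?_⟩
      rw [e, add_mul, h1, one_mul]
      have : pauli2 z + pauli2 z * (Q * P) = pauli2 z * (1 + Q * P) := by noncomm_ring
      rw [this, Matrix.mul_assoc, hun, Matrix.mul_smul, smul_smul]
      norm_num
    · obtain ⟨d, w, hw⟩ := pauli2_mul r s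
      obtain ⟨d', w', hw'⟩ := pauli2_mul z w
      refine ⟨-(d * d'), w', ?_⟩
      rw [e, add_mul, h1, one_mul]
      have : (pauli2 z + -(pauli2 z * (Q * P))) * (1 + P * Q) =
          pauli2 z * (1 + P * Q - Q * P - Q * P * (P * Q)) := by noncomm_ring
      rw [this, q1, h]
      have : (1 + -(Q * P) - Q * P - 1) = (-2 : ℂ) • (Q * P) := by
        rw [neg_smul, two_smul]; abel
      rw [this, Matrix.mul_smul, smul_smul, hP, hQ, hw, Matrix.mul_smul, hw', smul_smul, smul_smul]
      congr 1; ring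
  · rw [e]
    have : (1 + Q * P) * P * (1 + P * Q) =
      P + P * P * Q + Q * (P * P) + Q * (P * P) * (P * Q) := by noncomm_ring
    rw [this, hPP, one_mul, mul_one, h, mul_neg, ← mul_assoc, hQQ, one_mul]
    have : P + Q + Q + -P = (2 : ℂ) • Q := by rw [two_smul]; abel
    rw [this, smul_smul]; norm_num [hQ]

theorem Conn.of_sg {s r : Fin 2 → Fin 4} (h : sg (s 0) (r 0) * sg (s 1) (r 1) = -1) :
    Conn s r := by
  apply Conn.of_anti
  rw [pauli2_comm, h]; simp

theorem sg_exists : ∀ a b : Fin 4, ¬ (a = 0 ∧ b = 0) → ∀ a' b' : Fin 4, ¬ (a' = 0 ∧ b' = 0) →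
    ∃ c d, sg a c * sg b d = -1 ∧ sg c a' * sg d b' = -1 := by
  decide

theorem conn_all (a b : Fin 4) (h : ¬ (a = 0 ∧ b = 0)) (a' b' : Fin 4)
    (h' : ¬ (a' = 0 ∧ b' = 0)) : Conn ![a, b] ![a', b'] := by
  obtain ⟨c, d, h1, h2⟩ := sg_exists a b h a' b' h'
  exact (Conn.of_sg (r := ![c, d]) (by simpa using h1)).trans (Conn.of_sg (by simpa using h2))

theorem Conn.su {s r : Fin 2 → Fin 4} (h : Conn s r) :
    ∃ x : SU4, IsCliffordGate (x : Matrix (Fin 4) (Fin 4) ℂ) ∧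
      (x : Matrix (Fin 4) (Fin 4) ℂ) * pauli2 s * (x : Matrix (Fin 4) (Fin 4) ℂ)ᴴ = pauli2 r := by
  obtain ⟨u, hu, hc, he⟩ := h
  have hd : u.det * star u.det = 1 := by
    rw [← Matrix.det_conjTranspose, ← Matrix.det_mul, hu, Matrix.det_one]
  obtain ⟨c, hc4⟩ := IsAlgClosed.exists_pow_nat_eq (star u.det) (n := 4) (by norm_num)
  have hcn : c * star c = 1 := by
    have h1 : ‖u.det‖ = 1 := by
      have := congrArg norm hd
      rw [norm_mul, norm_star, norm_one] at this
      nlinarith [norm_nonneg u.det]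
    have h2 : ‖c‖ ^ 4 = 1 := by rw [← norm_pow, hc4, norm_star, h1]
    have h3 : ‖c‖ = 1 := (pow_eq_one_iff_of_nonneg (norm_nonneg c) (by norm_num)).1 h2
    have := Complex.mul_conj c
    rw [Complex.normSq_eq_norm_sq, h3] at this
    simpa using this
  have e : ∀ M, (c • u) * M * (c • u)ᴴ = u * M * uᴴ := by
    intro M
    rw [Matrix.conjTranspose_smul, Matrix.smul_mul, Matrix.smul_mul, Matrix.mul_smul, smul_smul,
      hcn, one_smul]
  refine ⟨⟨c • u, ?_⟩, ?_, ?_⟩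
  · rw [Matrix.mem_specialUnitaryGroup_iff]
    refine ⟨?_, ?_⟩
    · rw [Matrix.mem_unitaryGroup_iff]
      have := e 1
      rw [Matrix.mul_one, Matrix.mul_one, hu] at this
      exact this
    · rw [Matrix.det_smul, Fintype.card_fin, hc4, mul_comm, hd]
  · intro z
    obtain ⟨d, w, hw⟩ := hc z
    exact ⟨d, w, by rw [← hw]; exact e _⟩
  · rw [← he]; exact e _

/-! Embedding -/

noncomputable def E {n : ℕ} (p : Fin n × Fin n) (u : Matrix (Fin 4) (Fin 4) ℂ)
    (r : Fin n → Matrix (Fin 2) (Fin 2) ℂ) : NMatrix n := fun a b =>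
  u (pairIdx (a p.1) (a p.2)) (pairIdx (b p.1) (b p.2)) *
    ∏ i, if i = p.1 ∨ i = p.2 then 1 else r i (a i) (b i)

theorem embed_eq {n : ℕ} (p : Fin n × Fin n) (u : Matrix (Fin 4) (Fin 4) ℂ) :
    embedGate p u = E p u (fun _ => 1) := by
  ext a b
  unfold embedGate E
  split_ifs with h
  · rw [Finset.prod_eq_one, mul_one]
    intro i _
    split_ifs with h'
    · rfl
    · push Not at h'
      rw [h i h'.1 h'.2]; exact Matrix.one_apply_eq _
  · push Not at h
    obtain ⟨i, h1, h2, h3⟩ := h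
    rw [Finset.prod_eq_zero (Finset.mem_univ i), mul_zero]
    rw [if_neg (by tauto)]; exact Matrix.one_apply_ne h3

theorem string_eq {n : ℕ} (p : Fin n × Fin n) (hp : p.1 ≠ p.2) (s : Fin n → Fin 4) :
    pauliString s = E p (pauli2 ![s p.1, s p.2]) (fun i => pauli (s i)) := by
  ext a b
  unfold pauliString E
  have h1 : ∀ i, pauli (s i) (a i) (b i) =
      (if i = p.1 then pauli (s i) (a i) (b i) else 1) *
      (if i = p.2 then pauli (s i) (a i) (b i) else 1) *
      (if i = p.1 ∨ i = p.2 then 1 else pauli (s i) (a i) (b i)) := by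
    intro i
    by_cases h : i = p.1
    · have : i ≠ p.2 := fun h' => hp (h ▸ h')
      simp [h, hp]
    · by_cases h' : i = p.2
      · simp [h', hp.symm]
      · simp [h, h']
  rw [Finset.prod_congr rfl (fun i _ => h1 i), Finset.prod_mul_distrib, Finset.prod_mul_distrib,
    Finset.prod_ite_eq' , Finset.prod_ite_eq']
  simp only [Finset.mem_univ, if_true]
  congr 1
  have hd : ∀ x y : Fin 2, (⟨(pairIdx x y).val / 2, by have := (pairIdx x y).isLt; omega⟩ : Fin 2) = x := by
    decide
  have hm : ∀ x y : Fin 2, (⟨(pairIdx x y).val % 2, by have := (pairIdx x y).isLt; omega⟩ : Fin 2) = y := by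
    decide
  simp only [pauli2, hd, hm]
  rfl

theorem E_mul {n : ℕ} (p : Fin n × Fin n) (hp : p.1 ≠ p.2) (u v : Matrix (Fin 4) (Fin 4) ℂ)
    (r r' : Fin n → Matrix (Fin 2) (Fin 2) ℂ) :
    E p u r * E p v r' = E p (u * v) (fun i => r i * r' i) := by
  ext a b
  rw [Matrix.mul_apply]
  have key : ∀ x y : Fin 2, ∑ c : QubitBasis n,
      (∏ i, if i = p.1 then (if c i = x then (1:ℂ) else 0) else
        if i = p.2 then (if c i = y then 1 else 0) else r i (a i) (c i) * r' i (c i) (b i)) =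
      ∏ i, if i = p.1 ∨ i = p.2 then 1 else (r i * r' i) (a i) (b i) := by
    intro x y
    rw [← Fintype.prod_sum (fun (i : Fin n) (z : Fin 2) => if i = p.1 then (if z = x then (1:ℂ) else 0) else
        if i = p.2 then (if z = y then 1 else 0) else r i (a i) z * r' i z (b i))]
    refine Finset.prod_congr rfl fun i _ => ?_
    by_cases h : i = p.1
    · simp [h]
    · by_cases h' : i = p.2
      · simp [h', hp.symm]
      · simp [h, h', Matrix.mul_apply]
  have split : ∀ c : QubitBasis n, E p u r a c * E p v r' c b =
      ∑ x : Fin 2, ∑ y : Fin 2, u (pairIdx (a p.1) (a p.2)) (pairIdx x y) *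
        v (pairIdx x y) (pairIdx (b p.1) (b p.2)) *
        (∏ i, if i = p.1 then (if c i = x then (1:ℂ) else 0) else
        if i = p.2 then (if c i = y then 1 else 0) else r i (a i) (c i) * r' i (c i) (b i)) := by
    intro c
    rw [Finset.sum_eq_single (c p.1), Finset.sum_eq_single (c p.2)]
    · unfold E
      rw [mul_mul_mul_comm, ← Finset.prod_mul_distrib]
      congr 1
      refine Finset.prod_congr rfl fun i _ => ?_
      by_cases h : i = p.1
      · simp [h]
      · by_cases h' : i = p.2
        · simp [h', hp.symm]
        · simp [h, h']
    · intro y _ hy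
      rw [Finset.prod_eq_zero (Finset.mem_univ p.2), mul_zero]
      simp [hp.symm, hy.symm]
    · simp
    · intro x _ hx
      refine Finset.sum_eq_zero fun y _ => ?_
      rw [Finset.prod_eq_zero (Finset.mem_univ p.1), mul_zero]
      simp [hx.symm]
    · simp
  rw [Finset.sum_congr rfl fun c _ => split c, Finset.sum_comm]
  simp_rw [Finset.sum_comm (s := (Finset.univ : Finset (QubitBasis n))), ← Finset.mul_sum, key,
    ← Finset.sum_mul]
  unfold E
  congr 1
  rw [Matrix.mul_apply, Fin.sum_univ_four, Fin.sum_univ_two, Fin.sum_univ_two, Fin.sum_univ_two]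
  have e0 : pairIdx 0 0 = 0 := rfl
  have e1 : pairIdx 0 1 = 1 := rfl
  have e2 : pairIdx 1 0 = 2 := rfl
  have e3 : pairIdx 1 1 = 3 := rfl
  rw [e0, e1, e2, e3]
  ring

theorem embed_conj {n : ℕ} (p : Fin n × Fin n) (u : Matrix (Fin 4) (Fin 4) ℂ) :
    (embedGate p u)ᴴ = embedGate p uᴴ := by
  ext a b
  rw [Matrix.conjTranspose_apply]
  unfold embedGate
  by_cases h : ∀ i, i ≠ p.1 → i ≠ p.2 → a i = b i
  · rw [if_pos h, if_pos (fun i h1 h2 => (h i h1 h2).symm), Matrix.conjTranspose_apply]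
  · rw [if_neg h, if_neg (fun h' => h fun i h1 h2 => (h' i h1 h2).symm), star_zero]

theorem embed_step {n : ℕ} (p : Fin n × Fin n) (hp : p.1 ≠ p.2) (u : Matrix (Fin 4) (Fin 4) ℂ)
    (s s' : Fin n → Fin 4) (hs : ∀ i, i ≠ p.1 → i ≠ p.2 → s' i = s i)
    (h : u * pauli2 ![s p.1, s p.2] * uᴴ = pauli2 ![s' p.1, s' p.2]) :
    embedGate p u * pauliString s * (embedGate p u)ᴴ = pauliString s' := by
  rw [embed_conj, embed_eq, embed_eq, string_eq p hp s, E_mul p hp, E_mul p hp, h,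
    string_eq p hp s']
  ext a b
  unfold E
  congr 1
  refine Finset.prod_congr rfl fun i _ => ?_
  split_ifs with h'
  · rfl
  · push Not at h'
    beta_reduce
    rw [hs i h'.1 h'.2, Matrix.one_mul, Matrix.mul_one]

/-! Reachability -/

def tl {n L : ℕ} (A : Architecture n (L + 1)) : Architecture n L := fun i => A i.succ

def Reach {n : ℕ} (t : Fin n) : (L : ℕ) → Architecture n L → Fin n → Prop
  | 0, _, q => q = t
  | L + 1, A, q => Reach t L (tl A) q ∨ ((q = (A 0).1.1 ∨ q = (A 0).1.2) ∧
      (Reach t L (tl A) (A 0).1.1 ∨ Reach t L (tl A) (A 0).1.2))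

theorem reach_self {n : ℕ} (t : Fin n) : ∀ (L : ℕ) (A : Architecture n L), Reach t L A t
  | 0, _ => rfl
  | L + 1, A => Or.inl (reach_self t L (tl A))

theorem reach_of_path {n : ℕ} (t : Fin n) : ∀ (L : ℕ) (A : Architecture n L) (m : ℕ)
    (idx : Fin m → Fin L) (qs : Fin (m + 1) → Fin n), StrictMono idx →
    qs (Fin.last m) = t →
    (∀ l : Fin m,
      (qs l.castSucc = (A (idx l)).1.1 ∨ qs l.castSucc = (A (idx l)).1.2) ∧
      (qs l.succ = (A (idx l)).1.1 ∨ qs l.succ = (A (idx l)).1.2)) →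
    Reach t L A (qs 0) := by
  intro L
  induction L with
  | zero =>
    intro A m idx qs hm ht hq
    rcases m with _ | m
    · exact ht
    · exact (idx 0).elim0
  | succ L ih =>
    intro A m idx qs hm ht hq
    have shift : ∀ (m : ℕ) (idx : Fin m → Fin (L + 1)) (qs : Fin (m + 1) → Fin n),
        StrictMono idx → qs (Fin.last m) = t →
        (∀ l : Fin m,
          (qs l.castSucc = (A (idx l)).1.1 ∨ qs l.castSucc = (A (idx l)).1.2) ∧
          (qs l.succ = (A (idx l)).1.1 ∨ qs l.succ = (A (idx l)).1.2)) →
        (∀ l, idx l ≠ 0) → Reach t L (tl A) (qs 0) := by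
      intro m idx qs hm ht hq h0
      refine ih (tl A) m (fun l => (idx l).pred (h0 l)) qs ?_ ht ?_
      · intro i j hij
        exact Fin.pred_lt_pred_iff.2 (hm hij)
      · intro l
        have := hq l
        simpa [tl] using this
    rcases m with _ | m
    · have : qs 0 = t := ht
      rw [this]; exact reach_self t _ A
    · by_cases h0 : idx 0 = 0
      · right
        have h1 := hq 0
        rw [h0] at h1
        refine ⟨h1.1, ?_⟩
        have h2 : Reach t L (tl A) (qs (Fin.succ 0)) := by
          refine shift m (fun l => idx l.succ) (fun l => qs l.succ) ?_ ht ?_ ?_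
          · intro i j hij
            exact hm (Fin.succ_lt_succ_iff.2 hij)
          · intro l
            exact hq l.succ
          · intro l hl
            have := hm (Fin.succ_pos l)
            rw [hl] at this
            exact absurd this (Fin.not_lt_zero _)
        rcases h1.2 with h | h
        · left; rw [← h]; exact h2
        · right; rw [← h]; exact h2
      · left
        refine shift (m + 1) idx qs hm ht hq ?_
        intro l hl
        have h3 := hm.monotone (Fin.zero_le l)
        rw [hl] at h3
        exact h0 (Fin.le_zero_iff.1 h3)

theorem contract_succ {n L : ℕ} (A : Architecture n (L + 1)) (x : Fin (L + 1) → SU4) :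
    contract A x = contract (tl A) (fun i => x i.succ) *
      embedGate (A 0).1 (x 0 : Matrix (Fin 4) (Fin 4) ℂ) := by
  simp [contract, gateList, tl, List.ofFn_succ, List.prod_append]

/-- One step -/
theorem step {n L : ℕ} (A : Architecture n (L + 1)) (t : Fin n) (s : Fin n → Fin 4)
    (hs : ∃ i, s i ≠ 0) (hr : ∀ i, s i ≠ 0 → Reach t (L + 1) A i)
    (ht : s t = 0 ∨ s t = 3 ∨ ∃ l, t = (A l).1.1 ∨ t = (A l).1.2) :
    ∃ (x : SU4) (s' : Fin n → Fin 4), IsCliffordGate (x : Matrix (Fin 4) (Fin 4) ℂ) ∧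
      embedGate (A 0).1 (x : Matrix (Fin 4) (Fin 4) ℂ) * pauliString s *
        (embedGate (A 0).1 (x : Matrix (Fin 4) (Fin 4) ℂ))ᴴ = pauliString s' ∧
      (∃ i, s' i ≠ 0) ∧ (∀ i, s' i ≠ 0 → Reach t L (tl A) i) ∧
      (s' t = 0 ∨ s' t = 3 ∨ ∃ l, t = (tl A l).1.1 ∨ t = (tl A l).1.2) := by
  have hp := (A 0).2
  by_cases h0 : s (A 0).1.1 = 0 ∧ s (A 0).1.2 = 0
  · obtain ⟨x, hx, hx'⟩ := (Conn.refl ![s (A 0).1.1, s (A 0).1.2]).su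
    refine ⟨x, s, hx, embed_step _ hp _ s s (fun _ _ _ => rfl) hx', hs, ?_, ?_⟩
    · intro i hi
      rcases hr i hi with h | ⟨h | h, -⟩
      · exact h
      · exact absurd (h ▸ h0.1) hi
      · exact absurd (h ▸ h0.2) hi
    · rcases ht with h | h | ⟨l, hl⟩
      · exact Or.inl h
      · exact Or.inr (Or.inl h)
      · induction l using Fin.cases with
        | zero =>
          left
          rcases hl with h | h
          · rw [h]; exact h0.1
          · rw [h]; exact h0.2
        | succ l => exact Or.inr (Or.inr ⟨l, hl⟩)
  · -- choose the target
    obtain ⟨q, hq, hqr, hqt⟩ : ∃ q, (q = (A 0).1.1 ∨ q = (A 0).1.2) ∧ Reach t L (tl A) q ∧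
        (t = (A 0).1.1 ∨ t = (A 0).1.2 → q = t) := by
      by_cases h1 : t = (A 0).1.1 ∨ t = (A 0).1.2
      · exact ⟨t, h1, reach_self t _ _, fun _ => rfl⟩
      · have : Reach t L (tl A) (A 0).1.1 ∨ Reach t L (tl A) (A 0).1.2 := by
          by_cases h2 : s (A 0).1.1 = 0
          · rcases hr (A 0).1.2 (fun h => h0 ⟨h2, h⟩) with h | h
            · exact Or.inr h
            · exact h.2
          · rcases hr (A 0).1.1 h2 with h | h
            · exact Or.inl h
            · exact h.2
        rcases this with h | h
        · exact ⟨_, Or.inl rfl, h, fun h' => absurd h' h1⟩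
        · exact ⟨_, Or.inr rfl, h, fun h' => absurd h' h1⟩
    set s' : Fin n → Fin 4 := fun i => if i = q then 3 else
      if i = (A 0).1.1 ∨ i = (A 0).1.2 then 0 else s i with hs'
    have hsq : s' q = 3 := by simp [hs']
    have hne : ¬ (s' (A 0).1.1 = 0 ∧ s' (A 0).1.2 = 0) := by
      rintro ⟨h1, h2⟩
      rcases hq with h | h
      · rw [← h, hsq] at h1; exact absurd h1 (by decide)
      · rw [← h, hsq] at h2; exact absurd h2 (by decide)
    obtain ⟨x, hx, hx'⟩ := (conn_all _ _ h0 _ _ hne).su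
    have hout : ∀ i, i ≠ (A 0).1.1 → i ≠ (A 0).1.2 → s' i = s i := by
      intro i h1 h2
      have h3 : i ≠ q := by
        rintro rfl
        rcases hq with h | h
        · exact h1 h
        · exact h2 h
      simp [hs', h1, h2, h3]
    refine ⟨x, s', hx, embed_step _ hp _ s s' hout hx', ⟨q, by rw [hsq]; decide⟩, ?_, ?_⟩
    · intro i hi
      by_cases h1 : i = q
      · rw [h1]; exact hqr
      · by_cases h2 : i = (A 0).1.1 ∨ i = (A 0).1.2
        · exact absurd (by simp only [hs']; rw [if_neg h1, if_pos h2]) hi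
        · push Not at h2
          rw [hout i h2.1 h2.2] at hi
          rcases hr i hi with h | ⟨h | h, -⟩
          · exact h
          · exact absurd h h2.1
          · exact absurd h h2.2
    · by_cases h1 : t = (A 0).1.1 ∨ t = (A 0).1.2
      · right; left; rw [← hqt h1]; exact hsq
      · have h2 := h1
        push Not at h2
        rw [hout t h2.1 h2.2]
        rcases ht with h | h | ⟨l, hl⟩
        · exact Or.inl h
        · exact Or.inr (Or.inl h)
        · induction l using Fin.cases with
          | zero => exact absurd hl h1
          | succ l => exact Or.inr (Or.inr ⟨l, hl⟩)

theorem main {n : ℕ} (t : Fin n) : ∀ (L : ℕ) (A : Architecture n L) (s : Fin n → Fin 4),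
    (∃ i, s i ≠ 0) → (∀ i, s i ≠ 0 → Reach t L A i) →
    (s t = 0 ∨ s t = 3 ∨ ∃ l, t = (A l).1.1 ∨ t = (A l).1.2) →
    ∃ x : Fin L → SU4,
      (∀ i, IsCliffordGate (x i : Matrix (Fin 4) (Fin 4) ℂ)) ∧
      contract A x * pauliString s * (contract A x)ᴴ =
        pauliString (fun i => if i = t then (3 : Fin 4) else 0) := by
  intro L
  induction L with
  | zero =>
    intro A s hs hr ht
    refine ⟨fun i => i.elim0, fun i => i.elim0, ?_⟩
    have h1 : ∀ i, i ≠ t → s i = 0 := by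
      intro i hi
      by_contra h
      exact hi (hr i h)
    have h2 : s t = 3 := by
      rcases ht with h | h | ⟨l, -⟩
      · obtain ⟨i, hi⟩ := hs
        have : i = t := hr i hi
        exact absurd (this ▸ h) hi
      · exact h
      · exact l.elim0
    have h3 : s = fun i => if i = t then (3 : Fin 4) else 0 := by
      funext i
      split_ifs with h
      · rw [h, h2]
      · exact h1 i h
    rw [← h3]
    simp [contract, gateList]
  | succ L ih =>
    intro A s hs hr ht
    obtain ⟨x, s', hx, he, hs', hr', ht'⟩ := step A t s hs hr ht
    obtain ⟨y, hy, hye⟩ := ih (tl A) s' hs' hr' ht'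
    refine ⟨Fin.cons x y, ?_, ?_⟩
    · intro i
      induction i using Fin.cases with
      | zero => simpa using hx
      | succ i => simpa using hy i
    · rw [contract_succ, Matrix.conjTranspose_mul]
      simp only [Fin.cons_zero, Fin.cons_succ]
      rw [← hye, ← he]
      simp only [Matrix.mul_assoc]

end CausalAux

/-! ## Statement 8: a causal slice of Clifford gates mapping a Pauli string to `Z_t` -/

/-- **Clifford reduction along a causal slice.**  Let `A` be an `n`-qubit architecture with
`L` gates forming a single causal slice with sink qubit `t`.  Then for every nontrivial
`n`-qubit Pauli string `P` there are Clifford gates `u_1, …, u_L` such that the contracted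
unitary `C = F^A(u_1, …, u_L)` satisfies `C P C† = Z_t`. -/
theorem causal_slice_clifford_reduction
    (n L : ℕ) (hn : 2 ≤ n) (A : Architecture n L) (t : Fin n)
    (hA : IsCausalSliceWith A 0 L t)
    (s : Fin n → Fin 4) (hs : ∃ i, s i ≠ 0) :
    ∃ x : Fin L → SU4,
      (∀ i, IsCliffordGate (x i : Matrix (Fin 4) (Fin 4) ℂ)) ∧
      contract A x * pauliString s * (contract A x)ᴴ =
        pauliString (fun i => if i = t then (3 : Fin 4) else 0) := by
  have hact : ∃ l, t = (A l).1.1 ∨ t = (A l).1.2 := by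
    have : Nontrivial (Fin n) := Fin.nontrivial_iff_two_le.2 hn
    obtain ⟨q, hq⟩ := exists_ne t
    obtain ⟨m, idx, qs, -, -, h0, h1, h2⟩ := hA q
    rcases m with _ | m
    · exact absurd (h0.symm.trans h1) hq
    · refine ⟨idx (Fin.last m), ?_⟩
      rw [← h1]
      exact (h2 (Fin.last m)).2
  refine CausalAux.main t L A s hs ?_ (Or.inr (Or.inr hact))
  intro q _
  obtain ⟨m, idx, qs, hm, -, h0, h1, h2⟩ := hA q
  rw [← h0]
  exact CausalAux.reach_of_path t L A m idx qs hm h1 h2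
end
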